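/- Let F be a field of characteristic p > 0 with F^{p−1} = F (every element of F is a (p−1)-st power), and let {a_1, ..., a_r, e_1, ..., e_ℓ} ⊆ F be p-independent with r, ℓ ∈ ℕ_0. Then for every t ∈ {1, ..., ℓ}: (Σ_{i=1}^r d a_i ∧ Ω^{n−1}(F) + Σ over all subsets {i_1 < ... < i_t} ⊆ {1, ..., ℓ} of d e_{i_1} ∧ ... ∧ d e_{i_t} ∧ Ω^{n−t}(F)) ∩ ν_n(F) = [dx/x | x ∈ F^p(a_1, ..., a_r)^*] ∧ ν_{n−1}(F) + [dy_1/y_1 ∧ ... ∧ dy_t/y_t | y_1, ..., y_t ∈ F^p(a_1, ..., a_r, e_1, ..., e_ℓ)^*] ∧ ν_{n−t}(F). Moreover (the case ℓ = 0, t = 0): (Σ_{i=1}^r d a_i ∧ Ω^{n−1}(F)) ∩ ν_n(F) = [dx/x | x ∈ F^p(a_1, ..., a_r)^*] ∧ ν_{n−1}(F). -/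

import Mathlib

set_option synthInstance.maxHeartbeats 1000000
set_option maxHeartbeats 1000000

open ExteriorAlgebra

noncomputable section Preamble

variable (F : Type) [Field F] (p : ℕ)

/-- The subfield `F^{p^t}(C)` of `F` generated by the `p^t`-th powers and the set `C`. -/
def pClosureT (t : ℕ) (C : Set F) : Subfield F :=
  Subfield.closure ((Set.range fun x : F => x ^ p ^ t) ∪ C)

/-- The subfield `F^p(C)` of `F` generated by the `p`-th powers and the set `C`. -/
def pClosure (C : Set F) : Subfield F := pClosureT F p 1 C

/-- The degree `[B(A) : B]` for a subfield `B` of `F` and a subset `A ⊆ F`. -/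
def relDeg (B : Subfield F) (A : Set F) : ℕ :=
  Module.finrank B (IntermediateField.adjoin B A)

/-- `pdeg A = k`, i.e. `[F^p(A) : F^p] = p ^ k`. -/
def pDegEq (A : Set F) (k : ℕ) : Prop :=
  relDeg F (pClosure F p ∅) A = p ^ k

/-- A finite family `a : Fin n → F` is `p`-independent if `[F^p(a₁,…,aₙ) : F^p] = pⁿ`. -/
def pIndep {n : ℕ} (a : Fin n → F) : Prop :=
  pDegEq F p (Set.range a) n

/-- The exterior algebra of the absolute differential forms of `F`; the spaces `Ωⁿ(F)`
are its graded pieces and the wedge product is its multiplication. -/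
abbrev ExtOmega := ExteriorAlgebra F (Ω[F⁄ℤ])

/-- The differential `d a` of an element `a : F`, viewed in the exterior algebra. -/
def dform (a : F) : ExtOmega F :=
  ExteriorAlgebra.ι F (KaehlerDifferential.D ℤ F a)

/-- The space `Ωⁿ(F)` of `n`-differential forms, as a submodule of the exterior algebra;
it is `0` for `n < 0`. -/
def OmegaPow (n : ℤ) : Submodule F (ExtOmega F) :=
  if 0 ≤ n then ⋀[F]^(n.toNat) (Ω[F⁄ℤ]) else ⊥

/-- The wedge product `d a₁ ∧ … ∧ d aₙ` of the differentials of a family. -/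
def dwedge {n : ℕ} (a : Fin n → F) : ExtOmega F :=
  (List.ofFn fun i => dform F (a i)).prod

/-- The annihilator `annΩ^n_F(U)` of a set `U` of differential forms. -/
def annOmega (n : ℕ) (U : Set (ExtOmega F)) : Submodule F (ExtOmega F) :=
  OmegaPow F n ⊓ ⨅ u ∈ U, LinearMap.ker (LinearMap.mulRight F u)

/-- The logarithmic differential form `(dx₁/x₁) ∧ … ∧ (dxₙ/xₙ)`. -/
def logForm {n : ℕ} (x : Fin n → F) : ExtOmega F :=
  (List.ofFn fun i => ExteriorAlgebra.ι F ((x i)⁻¹ • KaehlerDifferential.D ℤ F (x i))).prod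

/-- The group `ν_n(F)`, additively generated by the logarithmic differential forms;
it is `0` for `n < 0`. -/
def nuPow (n : ℤ) : AddSubgroup (ExtOmega F) :=
  if 0 ≤ n then
    AddSubgroup.closure
      {ω | ∃ x : Fin n.toNat → F, (∀ i, x i ≠ 0) ∧ ω = logForm F x}
  else ⊥

/-- The annihilator `ann ν^n_F(U)`. -/
def annNu (n : ℕ) (U : Set (ExtOmega F)) : AddSubgroup (ExtOmega F) :=
  (annOmega F n U).toAddSubgroup ⊓ nuPow F n

/-- `η ∧ W` for a form `η` and a subspace `W`. -/
def wedgeL (η : ExtOmega F) (W : Submodule F (ExtOmega F)) : Submodule F (ExtOmega F) :=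
  W.map (LinearMap.mulLeft F η)

/-- The set `dS₁ ∧ … ∧ dSᵣ` for sets `S₁, …, Sᵣ ⊆ F`. -/
def dSet {r : ℕ} (S : Fin r → Set F) : Set (ExtOmega F) :=
  {ω | ∃ s : Fin r → F, (∀ i, s i ∈ S i) ∧ ω = dwedge F s}

/-- The additive subgroup `[dy₁/y₁ ∧ … ∧ dy_t/y_t ∣ yᵢ ∈ K^*] ∧ ν_m(F)` of `Ωⁿ(F)`
(for `n = t + m`). -/
def logWedgeNu (K : Set F) (t : ℕ) (m : ℤ) : AddSubgroup (ExtOmega F) :=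
  AddSubgroup.closure
    {ω | ∃ y : Fin t → F, (∀ i, y i ∈ K ∧ y i ≠ 0) ∧
      ∃ χ ∈ nuPow F m, ω = logForm F y * χ}

variable (E : Type) [Field E] [Algebra F E]

/-- The restriction map `Ω(F) → Ω(E)` on exterior algebras of differential forms,
induced by the inclusion `F ⊆ E`; it sends `d a` to `d a` and `x dа₁ ∧ … ∧ daₙ` to
the corresponding form over `E`. -/
def resMap : ExtOmega F →+* ExtOmega E :=
  letI : Algebra F (ExtOmega E) :=
    ((algebraMap E (ExtOmega E)).comp (algebraMap F E)).toAlgebra'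
      (fun c x => Algebra.commutes (algebraMap F E c) x)
  (ExteriorAlgebra.lift F ⟨{
      toFun := fun w =>
        ExteriorAlgebra.ι E (KaehlerDifferential.map ℤ ℤ F E w)
      map_add' := fun x y => by simp
      map_smul' := fun c x => by
        simp only [map_smul, RingHom.id_apply]
        rw [← algebraMap_smul E c (KaehlerDifferential.map ℤ ℤ F E x), map_smul,
          Algebra.smul_def, Algebra.smul_def]
        rfl },
    fun m => ExteriorAlgebra.ι_sq_zero _⟩).toRingHom

/-- The kernel `Ωⁿ(E/F)` of the restriction map `Ωⁿ(F) → Ωⁿ(E)`. -/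
def OmegaKer (n : ℕ) : Set (ExtOmega F) :=
  {ω | ω ∈ OmegaPow F n ∧ resMap F E ω = 0}

/-- The kernel `ν_n(E/F) = Ωⁿ(E/F) ∩ ν_n(F)`. -/
def nuKer (n : ℕ) : Set (ExtOmega F) :=
  OmegaKer F E n ∩ (nuPow F n : Set (ExtOmega F))

end Preamble

section FieldDerivations

variable {F : Type*} [Field F] {p : ℕ} [Fact p.Prime] [CharP F p]

/-- A Leibniz rule for `p`-fold iterates in characteristic `p`. -/
theorem pow_char_apply_mul {A B C : Module.End ℤ F}
    (h : ∀ f g, A (f * g) = B f * g + f * C g) (f g : F) :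
    (A ^ p) (f * g) = (B ^ p) f * g + f * (C ^ p) g := by
  let m : TensorProduct ℤ F F →ₗ[ℤ] F := LinearMap.mul' ℤ F
  let X : Module.End ℤ (TensorProduct ℤ F F) := TensorProduct.map B LinearMap.id
  let Y : Module.End ℤ (TensorProduct ℤ F F) := TensorProduct.map LinearMap.id C
  have hX1 (x y : F) : X (x ⊗ₜ[ℤ] y) = B x ⊗ₜ[ℤ] y := rfl
  have hY1 (x y : F) : Y (x ⊗ₜ[ℤ] y) = x ⊗ₜ[ℤ] C y := rfl
  have hX (n : ℕ) (x y : F) : (X ^ n) (x ⊗ₜ[ℤ] y) = ((B ^ n) x) ⊗ₜ[ℤ] y := by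
    induction n generalizing x with
    | zero => simp
    | succ n ih => rw [pow_succ, Module.End.mul_apply, hX1, ih, pow_succ, Module.End.mul_apply]
  have hY (n : ℕ) (x y : F) : (Y ^ n) (x ⊗ₜ[ℤ] y) = x ⊗ₜ[ℤ] ((C ^ n) y) := by
    induction n generalizing y with
    | zero => simp
    | succ n ih => rw [pow_succ, Module.End.mul_apply, hY1, ih, pow_succ, Module.End.mul_apply]
  have hcomm : Commute X Y := by
    refine LinearMap.ext fun z => ?_
    change X (Y z) = Y (X z)
    induction z with
    | zero => simp
    | tmul x y => rw [hX1, hY1, hX1, hY1]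
    | add x y hx hy => rw [map_add, map_add, map_add, map_add, hx, hy]
  have hA (z) : A (m z) = m ((X + Y) z) := by
    induction z with
    | zero => simp
    | tmul x y =>
      rw [LinearMap.add_apply, hX1, hY1, map_add]
      exact h x y
    | add x y hx hy => rw [map_add, map_add, map_add, map_add, hx, hy]
  have hAn (n : ℕ) (z) : (A ^ n) (m z) = m (((X + Y) ^ n) z) := by
    induction n generalizing z with
    | zero => simp
    | succ n ih =>
      rw [pow_succ, pow_succ, Module.End.mul_apply, Module.End.mul_apply, hA, ih]
  obtain ⟨r, hr⟩ := hcomm.exists_add_pow_prime_eq (Fact.out : p.Prime)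
  have := hAn p (f ⊗ₜ[ℤ] g)
  have hp : ((p : Module.End ℤ (TensorProduct ℤ F F)) * X * Y * r) (f ⊗ₜ[ℤ] g)
      = (p : ℕ) • ((X * Y * r) (f ⊗ₜ[ℤ] g)) := by
    rw [mul_assoc, mul_assoc, mul_assoc, ← nsmul_eq_mul, LinearMap.smul_apply]
  rw [hr, LinearMap.add_apply, LinearMap.add_apply, hX, hY, map_add, map_add, hp, map_nsmul,
    nsmul_eq_mul, CharP.cast_eq_zero, zero_mul, add_zero] at this
  exact this

/-- The operator `f ↦ D f + u f`. -/
def twist (D : Derivation ℤ F F) (u : F) : Module.End ℤ F :=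
  (D : F →ₗ[ℤ] F) + LinearMap.mulLeft ℤ u

@[simp] theorem twist_apply (D : Derivation ℤ F F) (u f : F) : twist D u f = D f + u * f := rfl

theorem twist_zero (D : Derivation ℤ F F) : twist D 0 = (D : F →ₗ[ℤ] F) := by
  ext; simp

theorem twist_pow_apply (D : Derivation ℤ F F) (u v f g : F) :
    (twist D (u + v) ^ p) (f * g) = (twist D u ^ p) f * g + f * (twist D v ^ p) g :=
  pow_char_apply_mul (fun f g => by simp; ring) f g

theorem twist_add_pow_one (D : Derivation ℤ F F) (u v : F) :
    (twist D (u + v) ^ p) 1 = (twist D u ^ p) 1 + (twist D v ^ p) 1 := by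
  simpa using twist_pow_apply (p := p) D u v 1 1

variable (p) in
/-- The `p`-th iterate of a derivation is a derivation in characteristic `p`. -/
def derivationPow (D : Derivation ℤ F F) : Derivation ℤ F F :=
  Derivation.mk' ((D : F →ₗ[ℤ] F) ^ p) fun a b => by
    have := pow_char_apply_mul (p := p) (A := (D : F →ₗ[ℤ] F)) (B := (D : F →ₗ[ℤ] F))
      (C := (D : F →ₗ[ℤ] F)) (fun f g => by simp; ring) a b
    rw [this]; simp; ring

theorem derivationPow_apply (D : Derivation ℤ F F) (x : F) :
    derivationPow p D x = ((D : F →ₗ[ℤ] F) ^ p) x := rfl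

omit [CharP F p] in
theorem derivation_zmod_cast (D : Derivation ℤ F F) (a : ZMod p) : D (a.cast : F) = 0 := by
  have : (a.cast : F) = ((a.val : ℕ) : F) := by
    rw [ZMod.natCast_val]
  rw [this]; exact D.map_natCast _

omit [Fact p.Prime] in
theorem derivation_pow_char (D : Derivation ℤ F F) (x : F) : D (x ^ p) = 0 := by
  rw [Derivation.leibniz_pow, ← Nat.cast_smul_eq_nsmul F, CharP.cast_eq_zero, zero_smul]

theorem prod_X_sub_C_zmod :
    ∏ a : ZMod p, (Polynomial.X - Polynomial.C a) = Polynomial.X ^ p - Polynomial.X := by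
  have h := FiniteField.roots_X_pow_card_sub_X (ZMod p)
  have h1 : 1 < p := (Fact.out : p.Prime).one_lt
  rw [ZMod.card] at h
  have hm : (Polynomial.X ^ p - Polynomial.X : Polynomial (ZMod p)).Monic := by
    simpa using Polynomial.monic_X_pow_sub (n := p) (p := (Polynomial.X : Polynomial (ZMod p)))
      (by simpa using h1)
  have := Polynomial.prod_multiset_X_sub_C_of_monic_of_roots_card_eq hm (by
    rw [h, FiniteField.X_pow_card_sub_X_natDegree_eq (ZMod p) h1]
    simp [ZMod.card])
  rw [h] at this
  exact this

section Idempotent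

variable (D : Derivation ℤ F F) (hD : ∀ x, ((D : F →ₗ[ℤ] F) ^ p) x = D x)

/-- the eigenvalue case of Hochschild's formula. -/
theorem twist_pow_one_of_eigen (i : ZMod p) (u : F) (hu : D u = (i.cast : F) * u) :
    (twist D u ^ p) 1 = ((D : F →ₗ[ℤ] F) ^ (p - 1)) u + u ^ p := by
  let _ : Algebra (ZMod p) F := ZMod.algebra F p
  have hcast (a : ZMod p) : algebraMap (ZMod p) F a = a.cast := rfl
  have hp : p - 1 + 1 = p := Nat.succ_pred_prime Fact.out
  have hp0 : p ≠ 0 := (Fact.out : p.Prime).ne_zero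
  have hDn (n : ℕ) : ((D : F →ₗ[ℤ] F) ^ n) u = (i.cast : F) ^ n * u := by
    induction n with
    | zero => simp
    | succ n ih =>
      rw [pow_succ', Module.End.mul_apply, ih]
      have : D ((i.cast : F) ^ n) = 0 := by
        rw [Derivation.leibniz_pow, derivation_zmod_cast]; simp
      simp [this, hu]; ring
  have hup (n : ℕ) : D (u ^ n) = n * (i.cast : F) * u ^ n := by
    rcases n with _ | n
    · simp
    · rw [Derivation.leibniz_pow, hu]; simp; ring
  rw [hDn]
  by_cases hi : i = 0
  · subst hi
    have : ∀ n : ℕ, (twist D u ^ n) 1 = u ^ n := by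
      intro n
      induction n with
      | zero => simp
      | succ n ih =>
        rw [pow_succ', Module.End.mul_apply, ih, twist_apply, hup]; simp; ring
    rw [this]
    have : p - 1 ≠ 0 := by have := (Fact.out : p.Prime).two_le; omega
    simp [this]
  · let E : Module.End (ZMod p) F :=
      { toFun := twist D u
        map_add' := map_add _
        map_smul' := fun c x => by
          simp [Algebra.smul_def, hcast, derivation_zmod_cast]; ring }
    have hE (x : F) : E x = D x + u * x := rfl
    have hEn (n : ℕ) (x : F) : (E ^ n) x = (twist D u ^ n) x := by
      induction n generalizing x with
      | zero => simp
      | succ n ih => rw [pow_succ, pow_succ, Module.End.mul_apply, Module.End.mul_apply, ih]; rfl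
    have key (n : ℕ) : (Polynomial.aeval E (∏ k ∈ Finset.range n,
        (Polynomial.X - Polynomial.C ((k : ZMod p) * i)))) 1 = u ^ n := by
      induction n with
      | zero => simp
      | succ n ih =>
        rw [Finset.prod_range_succ, mul_comm, map_mul, Module.End.mul_apply, ih]
        rw [map_sub, Polynomial.aeval_X, Polynomial.aeval_C, LinearMap.sub_apply, hE, hup,
          Module.algebraMap_end_apply, Algebra.smul_def, map_mul, map_natCast, hcast]
        ring
    have hprod : ∏ k ∈ Finset.range p, (Polynomial.X - Polynomial.C ((k : ZMod p) * i))
        = Polynomial.X ^ p - Polynomial.X := by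
      rw [← prod_X_sub_C_zmod]
      refine Finset.prod_bij' (fun k _ => (k : ZMod p) * i) (fun a _ => (a * i⁻¹).val)
        (by simp) (fun a _ => by simpa using ZMod.val_lt _) (fun k hk => ?_) (fun a _ => ?_)
        (by simp)
      · simp [hi, ZMod.val_cast_of_lt (Finset.mem_range.1 hk)]
      · simp [hi]
    have := key p
    rw [hprod] at this
    simp only [map_sub, map_pow, Polynomial.aeval_X, LinearMap.sub_apply, hEn, hE] at this
    have h1 : (i.cast : F) ^ (p - 1) = 1 := by
      rw [← hcast, ← map_pow, ZMod.pow_card_sub_one_eq_one hi, map_one]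
    rw [h1, ← this]; simp

include hD in
theorem exists_sum_eigen (u : F) : ∃ v : ZMod p → F, u = ∑ i, v i ∧
    ∀ i, D (v i) = (i.cast : F) * v i := by
  let _ : Algebra (ZMod p) F := ZMod.algebra F p
  have hcast (a : ZMod p) : algebraMap (ZMod p) F a = a.cast := rfl
  have hp : p - 1 + 1 = p := Nat.succ_pred_prime Fact.out
  have hp2 := (Fact.out : p.Prime).two_le
  let P := (D : F →ₗ[ℤ] F)
  let w : ZMod p → F := fun i =>
    - ∑ k ∈ Finset.range (p - 1), ((i⁻¹ ^ (k + 1)).cast : F) * (P ^ (k + 1)) u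
  refine ⟨fun i => if i = 0 then u - (P ^ (p - 1)) u else w i, ?_, ?_⟩
  · rw [← Finset.add_sum_erase _ _ (Finset.mem_univ 0), if_pos rfl,
      Finset.sum_congr rfl (g := w) (fun i hi => if_neg (Finset.ne_of_mem_erase hi))]
    have : ∑ i ∈ Finset.univ.erase (0 : ZMod p), w i = (P ^ (p - 1)) u := by
      simp only [w, Finset.sum_neg_distrib]
      rw [Finset.sum_comm]
      have hin (k : ℕ) : ∑ i ∈ Finset.univ.erase (0 : ZMod p), ((i⁻¹ ^ (k + 1)).cast : F)
          = if (p - 1) ∣ (k + 1) then -1 else 0 := by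
        have h1 := FiniteField.sum_pow_units (ZMod p) (k + 1)
        rw [ZMod.card] at h1
        have h2 : ∑ i ∈ Finset.univ.erase (0 : ZMod p), i⁻¹ ^ (k + 1) =
            if (p - 1) ∣ (k + 1) then -1 else 0 := by
          rw [← h1]
          refine Finset.sum_bij' (fun i hi => (Units.mk0 i (Finset.ne_of_mem_erase hi))⁻¹)
            (fun a _ => ((a⁻¹ : (ZMod p)ˣ) : ZMod p)) (by simp)
            (fun a _ => by
              rw [Finset.mem_erase]; exact ⟨Units.ne_zero _, Finset.mem_univ _⟩)
            (fun a _ => by rw [inv_inv, Units.val_mk0])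
            (fun a _ => by rw [inv_eq_iff_eq_inv]; ext; rfl) (by simp)
        simp only [← hcast]
        rw [← map_sum, h2]
        split_ifs <;> simp
      simp only [← Finset.sum_mul, hin]
      rw [Finset.sum_eq_single (p - 2)]
      · have : p - 2 + 1 = p - 1 := by omega
        simp [this]
      · intro k hk hk2
        have hk := Finset.mem_range.1 hk
        rw [if_neg, zero_mul]
        intro hd
        have := Nat.le_of_dvd (by omega) hd
        omega
      · intro h
        simp at h; omega
    rw [this]; ring
  · intro i
    have hPs (k : ℕ) (x : F) : D ((P ^ k) x) = (P ^ (k + 1)) x := by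
      rw [pow_succ', Module.End.mul_apply]; rfl
    by_cases hi : i = 0
    · simp only [hi, if_pos]
      rw [map_sub, hPs, hp, hD]; simp
    · simp only [if_neg hi, w]
      rw [map_neg, map_sum, mul_neg, Finset.mul_sum]
      congr 1
      have hterm (k : ℕ) : D (((i⁻¹ ^ (k + 1)).cast : F) * (P ^ (k + 1)) u) =
          ((i⁻¹ ^ (k + 1)).cast : F) * (P ^ (k + 2)) u := by
        rw [Derivation.leibniz, derivation_zmod_cast, hPs]; simp
      have hterm' (k : ℕ) : (i.cast : F) * (((i⁻¹ ^ (k + 1)).cast : F) * (P ^ (k + 1)) u) =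
          ((i⁻¹ ^ k).cast : F) * (P ^ (k + 1)) u := by
        simp only [← hcast]
        rw [← mul_assoc, ← map_mul, pow_succ', mul_inv_cancel_left₀ hi]
      simp only [hterm, hterm']
      have hs1 := Finset.sum_range_succ' (fun k => ((i⁻¹ ^ k).cast : F) * (P ^ (k + 1)) u) (p - 2)
      have hs2 := Finset.sum_range_succ
        (fun k => ((i⁻¹ ^ (k + 1)).cast : F) * (P ^ (k + 2)) u) (p - 2)
      have e2 : p - 2 + 1 = p - 1 := by omega
      have e3 : p - 2 + 2 = p := by omega
      rw [e2] at hs1 hs2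
      rw [hs1, hs2, e3, hD, ZMod.pow_card_sub_one_eq_one (inv_ne_zero hi)]
      simp [P]

include hD in
/-- Hochschild's formula. -/
theorem twist_pow_one (u : F) :
    (twist D u ^ p) 1 = ((D : F →ₗ[ℤ] F) ^ (p - 1)) u + u ^ p := by
  obtain ⟨v, rfl, hv⟩ := exists_sum_eigen D hD u
  have hp0 : p ≠ 0 := (Fact.out : p.Prime).ne_zero
  have (s : Finset (ZMod p)) : (twist D (∑ i ∈ s, v i) ^ p) 1 =
      ((D : F →ₗ[ℤ] F) ^ (p - 1)) (∑ i ∈ s, v i) + (∑ i ∈ s, v i) ^ p := by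
    induction s using Finset.induction_on with
    | empty =>
      rw [Finset.sum_empty, twist_zero, hD]; simp [hp0]
    | insert a s ha ih =>
      rw [Finset.sum_insert ha, twist_add_pow_one, ih, twist_pow_one_of_eigen D a _ (hv a), map_add,
        add_pow_char]; ring
  exact this _

include hD in
/-- Logarithmic derivatives are fixed by the Cartier operator. -/
theorem logDeriv_pow_char (x : F) (hx : x ≠ 0) :
    (x⁻¹ * D x) ^ p = x⁻¹ * D x - ((D : F →ₗ[ℤ] F) ^ (p - 1)) (x⁻¹ * D x) := by
  set u := x⁻¹ * D x with hu
  have h1 := twist_pow_one D hD u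
  have h2 := twist_pow_apply (p := p) D 0 u x⁻¹ x
  have h3 := twist_pow_apply (p := p) D (-u) u x 1
  have hp1 : 1 ≤ p := (Fact.out : p.Prime).one_le
  have h4 : (twist D (-u) ^ p) x = 0 := by
    rw [← Nat.sub_add_cancel hp1, pow_succ, Module.End.mul_apply]
    have : twist D (-u) x = 0 := by
      rw [twist_apply, hu]; field_simp; ring
    rw [this, map_zero]
  rw [neg_add_cancel, twist_zero, hD, h4, h1] at h3
  have : x * u = D x := by rw [hu]; field_simp
  simp only [mul_one, zero_add] at h3
  rw [← this] at h3
  have := mul_left_cancel₀ hx h3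
  rw [eq_sub_iff_add_eq, add_comm]; exact this.symm

include hD in
/-- Jacobson's criterion: `v` is a logarithmic derivative if it is fixed by the Cartier operator.
The solution is found in any subfield `K` stable under `D` which contains `v` and an
eigenvector `b` of eigenvalue one. -/
theorem exists_logDeriv_eq (K : Subfield F) (hK : ∀ x ∈ K, D x ∈ K) {v b : F} (hv : v ∈ K)
    (hb : b ∈ K) (hb0 : b ≠ 0) (hDb : D b = b)
    (h : v ^ p = v - ((D : F →ₗ[ℤ] F) ^ (p - 1)) v) :
    ∃ x ∈ K, x ≠ 0 ∧ D x = v * x := by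
  let _ : Algebra (ZMod p) F := ZMod.algebra F p
  have hcast (a : ZMod p) : algebraMap (ZMod p) F a = a.cast := rfl
  let E : Module.End (ZMod p) F :=
    { toFun := twist D (-v)
      map_add' := map_add _
      map_smul' := fun c x => by
        simp [Algebra.smul_def, hcast, derivation_zmod_cast]; ring }
  have hE (x : F) : E x = D x - v * x := by
    change D x + -v * x = _; ring
  have hEn (n : ℕ) (x : F) : (E ^ n) x = (twist D (-v) ^ n) x := by
    induction n generalizing x with
    | zero => simp
    | succ n ih => rw [pow_succ, pow_succ, Module.End.mul_apply, Module.End.mul_apply, ih]; rfl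
  have hEp (f : F) : (E ^ p) f = E f := by
    have h1 := twist_pow_apply (p := p) D 0 (-v) f 1
    have h2 := twist_pow_one D hD (-v)
    have h3 : (-v) ^ p = - v ^ p := by
      have := sub_pow_char (p := p) (0 : F) v
      rw [zero_sub, zero_pow (Fact.out : p.Prime).ne_zero, zero_sub] at this
      exact this
    rw [zero_add, mul_one, twist_zero, hD, h2, h3, h, map_neg] at h1
    rw [hEn, h1, hE]; ring
  have hprod (s : Finset (ZMod p)) : ∀ f ∈ K, f ≠ 0 →
      (Polynomial.aeval E (∏ a ∈ s, (Polynomial.X - Polynomial.C a))) f = 0 →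
      ∃ a : ZMod p, ∃ g ∈ K, g ≠ 0 ∧ E g = (a.cast : F) * g := by
    induction s using Finset.induction_on with
    | empty => intro f _ hf h; simp at h; contradiction
    | insert a s ha ih =>
      intro f hfK hf h
      rw [Finset.prod_insert ha, mul_comm, map_mul, Module.End.mul_apply] at h
      have hX : Polynomial.aeval E (Polynomial.X - Polynomial.C a) f = E f - (a.cast : F) * f := by
        rw [map_sub, Polynomial.aeval_X, Polynomial.aeval_C, LinearMap.sub_apply,
          Module.algebraMap_end_apply, Algebra.smul_def, hcast]
      rw [hX] at h
      by_cases h0 : E f - (a.cast : F) * f = 0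
      · exact ⟨a, f, hfK, hf, sub_eq_zero.1 h0⟩
      · refine ih _ ?_ h0 h
        rw [hE]
        refine sub_mem (sub_mem (hK _ hfK) (mul_mem hv hfK)) (mul_mem ?_ hfK)
        rw [← ZMod.natCast_val]; exact natCast_mem _ _
  obtain ⟨a, g, hgK, hg, hEg⟩ := hprod Finset.univ 1 (one_mem _) one_ne_zero (by
    rw [prod_X_sub_C_zmod]
    simp [hEp])
  refine ⟨g * (b ^ a.val)⁻¹, mul_mem hgK (inv_mem (pow_mem hb _)), by positivity, ?_⟩
  rw [hE, ← ZMod.natCast_val] at hEg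
  have hbn : D (b ^ a.val) = a.val * b ^ a.val := by
    rcases hn : a.val with _ | n
    · simp
    · rw [Derivation.leibniz_pow, hDb, Nat.add_sub_cancel, smul_eq_mul, nsmul_eq_mul, pow_succ]
  have h5 : D ((b ^ a.val)⁻¹) = - a.val * (b ^ a.val)⁻¹ := by
    rw [Derivation.leibniz_inv, hbn]
    have : b ^ a.val ≠ 0 := pow_ne_zero _ hb0
    simp only [smul_eq_mul]
    field_simp
  rw [Derivation.leibniz, h5, sub_eq_iff_eq_add.1 hEg]
  simp only [smul_eq_mul]; ring

end Idempotent

end FieldDerivations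

section Determinants

variable {F : Type*} [Field F]

theorem Derivation.map_prod_eq_sum {ι : Type*} [DecidableEq ι] (D : Derivation ℤ F F)
    (s : Finset ι) (f : ι → F) :
    D (∏ i ∈ s, f i) = ∑ i ∈ s, ∏ j ∈ s, Function.update f i (D (f i)) j := by
  induction s using Finset.induction_on with
  | empty => simp
  | insert a s ha ih =>
    rw [Finset.prod_insert ha, Derivation.leibniz, ih, Finset.sum_insert ha, Finset.prod_insert ha,
      add_comm, Function.update_self, smul_eq_mul, smul_eq_mul, Finset.mul_sum, mul_comm]
    congr 1
    · congr 1
      exact Finset.prod_congr rfl fun j hj => by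
        rw [Function.update_of_ne (ne_of_mem_of_not_mem hj ha)]
    · refine Finset.sum_congr rfl fun i hi => ?_
      rw [Finset.prod_insert ha, Function.update_of_ne (ne_of_mem_of_not_mem hi ha).symm]

theorem Derivation.map_det {m : Type*} [Fintype m] [DecidableEq m] (D : Derivation ℤ F F)
    (M : Matrix m m F) : D M.det = ∑ k, (M.updateCol k fun i => D (M i k)).det := by
  simp only [Matrix.det_apply, map_sum]
  rw [Finset.sum_comm]
  refine Finset.sum_congr rfl fun σ _ => ?_
  rw [← Finset.smul_sum, Units.smul_def, map_zsmul, Units.smul_def, D.map_prod_eq_sum]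
  congr 1
  refine Finset.sum_congr rfl fun k _ => Finset.prod_congr rfl fun j _ => ?_
  by_cases h : j = k
  · subst h; simp
  · simp [h]

variable {I : Type*} (D : I → Derivation ℤ F F)

/-- Cofactors along one column of a matrix all of whose other columns are closed form a
divergence-free vector. -/
theorem sum_derivation_cramer {m : Type*} [Fintype m] [DecidableEq m] (τ : m → I)
    (M : Matrix m m F) (k : m)
    (hM : ∀ k', k' ≠ k → ∀ i j, D (τ i) (M j k') = D (τ j) (M i k')) :
    ∑ i, D (τ i) (Matrix.cramer M (Pi.single i 1) k) = 0 := by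
  simp only [Matrix.cramer_apply, Derivation.map_det]
  rw [Finset.sum_comm]
  refine Finset.sum_eq_zero fun k' _ => ?_
  by_cases hk : k' = k
  · subst hk
    refine Finset.sum_eq_zero fun i _ => Matrix.det_eq_zero_of_column_eq_zero k' fun j => ?_
    by_cases hij : i = j
    · subst hij; simp
    · simp [Pi.single_apply, eq_comm, hij]
  let B : m → m → F := fun i j =>
    ((M.updateCol k (Pi.single i 1)).updateCol k' (Pi.single j 1)).det
  have hB (i j : m) : B i j + B j i = 0 := by
    have hs : B j i = ((M.updateCol k (Pi.single i 1)).updateCol k' (Pi.single j 1)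
        |>.submatrix id (Equiv.swap k k')).det := by
      refine congrArg Matrix.det (Matrix.ext fun a b => ?_)
      by_cases h1 : b = k
      · subst h1
        simp [Ne.symm hk]
      by_cases h2 : b = k'
      · subst h2
        simp [Ne.symm hk]
      · simp [Equiv.swap_apply_of_ne_of_ne h1 h2, h1, h2]
    rw [hs, Matrix.det_permute', Equiv.Perm.sign_swap (Ne.symm hk)]
    simp [B]
  have hB0 (i : m) : B i i = 0 :=
    Matrix.det_zero_of_column_eq (Ne.symm hk) fun a => by simp [Ne.symm hk]
  have hexp (i : m) : ((M.updateCol k (Pi.single i 1)).updateCol k' fun j =>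
      D (τ i) (M.updateCol k (Pi.single i 1) j k')).det
      = ∑ j, D (τ i) (M j k') * B i j := by
    have h := LinearMap.pi_apply_eq_sum_univ
      (LinearMap.proj k' ∘ₗ Matrix.cramer (M.updateCol k (Pi.single i 1)))
      (fun j => D (τ i) (M j k'))
    simp only [LinearMap.comp_apply, LinearMap.proj_apply, Matrix.cramer_apply, smul_eq_mul] at h
    simp only [Matrix.updateCol_ne hk]
    rw [h]
    refine Finset.sum_congr rfl fun j _ => ?_
    congr 3
    ext b
    simp [Pi.single_apply, eq_comm]
  simp only [hexp]
  rw [← Finset.sum_product']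
  refine Finset.sum_involution (fun x _ => (x.2, x.1)) ?_ ?_ (by simp) (by simp)
  · rintro ⟨i, j⟩ -
    simp only
    rw [hM k' hk i j, ← mul_add, hB, mul_zero]
  · rintro ⟨i, j⟩ - hne h
    simp only [Prod.mk.injEq] at h
    obtain ⟨rfl, -⟩ := h
    simp [hB0] at hne

/-- The subgroup generated by the images of the derivations with index in `T`. -/
def derivationSpan (T : Set I) : AddSubgroup F :=
  AddSubgroup.closure {y | ∃ i ∈ T, ∃ x, D i x = y}

theorem mem_derivationSpan {T : Set I} {i : I} (hi : i ∈ T) (x : F) :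
    D i x ∈ derivationSpan D T :=
  AddSubgroup.subset_closure ⟨i, hi, x, rfl⟩

theorem det_updateCol_derivation_mem {m : Type*} [Fintype m] [DecidableEq m] (τ : m → I)
    (M : Matrix m m F) (k : m) (h : F)
    (hM : ∀ k', k' ≠ k → ∀ i j, D (τ i) (M j k') = D (τ j) (M i k')) :
    (M.updateCol k fun i => D (τ i) h).det ∈ derivationSpan D (Set.range τ) := by
  have h1 := LinearMap.pi_apply_eq_sum_univ (LinearMap.proj k ∘ₗ Matrix.cramer M)
      (fun i => D (τ i) h)
  simp only [LinearMap.comp_apply, LinearMap.proj_apply, smul_eq_mul] at h1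
  have h2 (i : m) : (fun j => if i = j then (1 : F) else 0) = Pi.single i 1 := by
    ext j; simp [Pi.single_apply, eq_comm]
  simp only [h2] at h1
  have h3 : ∑ i, D (τ i) (h * Matrix.cramer M (Pi.single i 1) k) =
      ∑ i, D (τ i) h * Matrix.cramer M (Pi.single i 1) k := by
    simp only [Derivation.leibniz, smul_eq_mul, Finset.sum_add_distrib]
    rw [← Finset.mul_sum, sum_derivation_cramer D τ M k hM, mul_zero, zero_add]
    exact Finset.sum_congr rfl fun i _ => mul_comm _ _
  rw [← Matrix.cramer_apply, h1, ← h3]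
  exact sum_mem fun i _ => mem_derivationSpan D (Set.mem_range_self i) _

/-- The determinant of a matrix with closed columns changes by a sum of derivatives when each
column is changed by a gradient. -/
theorem det_sub_det_mem {m : Type*} [Fintype m] [DecidableEq m] (τ : m → I)
    (M N : Matrix m m F) (h : m → F)
    (hM : ∀ k i j, D (τ i) (M j k) = D (τ j) (M i k))
    (hN : ∀ k i j, D (τ i) (N j k) = D (τ j) (N i k))
    (hMN : ∀ i k, N i k = M i k - D (τ i) (h k)) :
    N.det - M.det ∈ derivationSpan D (Set.range τ) := by
  have key (s : Finset m) : (Matrix.of fun i k => if k ∈ s then N i k else M i k).det - M.det ∈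
      derivationSpan D (Set.range τ) := by
    induction s using Finset.induction_on with
    | empty =>
      have : (Matrix.of fun i k => if k ∈ (∅ : Finset m) then N i k else M i k) = M := by
        ext; simp
      rw [this, sub_self]; exact zero_mem _
    | insert a s ha ih =>
      set P := (Matrix.of fun i k => if k ∈ s then N i k else M i k) with hP
      have h1 : (Matrix.of fun i k => if k ∈ insert a s then N i k else M i k) =
          P.updateCol a ((fun i => M i a) - fun i => D (τ i) (h a)) := by
        ext i k
        by_cases hk : k = a
        · subst hk; simp [hMN]
        · simp [hP, hk]
      have h2 : P.updateCol a (fun i => M i a) = P := by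
        ext i k
        by_cases hk : k = a
        · subst hk; simp [hP, ha]
        · simp [hk]
      have h3 := det_updateCol_derivation_mem D τ P a (h a) fun k _ i j => by
        simp only [hP, Matrix.of_apply]
        split_ifs
        · exact hN k i j
        · exact hM k i j
      rw [h1, ← Matrix.cramer_apply, map_sub, Pi.sub_apply, Matrix.cramer_apply,
        Matrix.cramer_apply, h2, sub_right_comm]
      exact sub_mem ih h3
  convert key Finset.univ using 3
  ext; simp

end Determinants

section CommutingDerivations

variable {F : Type*} [Field F] {p : ℕ} [Fact p.Prime] [CharP F p] {I : Type*}
  (D : I → Derivation ℤ F F) (hcomm : ∀ i j x, D i (D j x) = D j (D i x))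
  (hD : ∀ i x, ((D i : F →ₗ[ℤ] F) ^ p) x = D i x)

include hcomm in
theorem derivation_pow_comm (i j : I) (n : ℕ) (x : F) :
    D i (((D j : F →ₗ[ℤ] F) ^ n) x) = ((D j : F →ₗ[ℤ] F) ^ n) (D i x) := by
  induction n generalizing x with
  | zero => rfl
  | succ n ih =>
    rw [pow_succ, Module.End.mul_apply, Module.End.mul_apply, ih]
    congr 1
    exact hcomm i j x

omit [CharP F p] in
include hcomm hD in
/-- A Poincaré lemma for commuting derivations with `D ^ p = D`. -/
theorem exists_potential (S : Finset I) (g : I → F)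
    (hg : ∀ i ∈ S, ∀ j ∈ S, D i (g j) = D j (g i))
    (hg' : ∀ i ∈ S, ((D i : F →ₗ[ℤ] F) ^ (p - 1)) (g i) = g i) :
    ∃ h, ∀ i ∈ S, D i h = g i := by
  classical
  have hp2 := (Fact.out : p.Prime).two_le
  induction S using Finset.induction_on with
  | empty => simp
  | insert j S hj ih =>
    obtain ⟨h, hh⟩ := ih (fun i hi k hk => hg i (Finset.mem_insert_of_mem hi) k
      (Finset.mem_insert_of_mem hk)) (fun i hi => hg' i (Finset.mem_insert_of_mem hi))
    refine ⟨h + ((D j : F →ₗ[ℤ] F) ^ (p - 2)) (g j - D j h), fun i hi => ?_⟩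
    rw [Finset.mem_insert] at hi
    have h_succ (x : F) : D j (((D j : F →ₗ[ℤ] F) ^ (p - 2)) x) =
        ((D j : F →ₗ[ℤ] F) ^ (p - 1)) x := by
      rw [show p - 1 = p - 2 + 1 by omega, pow_succ', Module.End.mul_apply]; rfl
    have hlast (x : F) : ((D j : F →ₗ[ℤ] F) ^ (p - 1)) (D j x) = D j x := by
      rw [← hD j x]
      conv_rhs => rw [show p = p - 1 + 1 by omega, pow_succ, Module.End.mul_apply]
      rw [hD j x]; rfl
    rcases hi with rfl | hi
    · rw [map_add, h_succ, map_sub, hlast, hg' i (Finset.mem_insert_self _ _)]; ring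
    · rw [map_add, derivation_pow_comm D hcomm, map_sub, hcomm i j, hh i hi,
        hg i (Finset.mem_insert_of_mem hi) j (Finset.mem_insert_self _ _), sub_self, map_zero,
        add_zero]

include hcomm in
theorem logDeriv_closed (x : F) (i j : I) :
    D i (x⁻¹ * D j x) = D j (x⁻¹ * D i x) := by
  rw [Derivation.leibniz, Derivation.leibniz, Derivation.leibniz_inv, Derivation.leibniz_inv,
    hcomm i j]
  simp only [smul_eq_mul]; ring

include hcomm hD in
/-- The Artin–Schreier condition satisfied by the coefficients of logarithmic forms. -/
theorem logDeriv_det_pow_sub_mem {m : Type*} [Fintype m] [DecidableEq m] (τ : m → I)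
    (x : m → F) (hx : ∀ k, x k ≠ 0) :
    (Matrix.of fun i k => (x k)⁻¹ * D (τ i) (x k)).det ^ p -
      (Matrix.of fun i k => (x k)⁻¹ * D (τ i) (x k)).det ∈ derivationSpan D (Set.range τ) := by
  classical
  have hp2 := (Fact.out : p.Prime).two_le
  have hpot (k : m) := exists_potential D hcomm hD (Finset.univ.image τ)
    (fun i => ((D i : F →ₗ[ℤ] F) ^ (p - 1)) ((x k)⁻¹ * D i (x k)))
    (fun i _ j _ => by
      have h1 (i : I) : ((D i : F →ₗ[ℤ] F) ^ (p - 1)) ((x k)⁻¹ * D i (x k)) =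
          (x k)⁻¹ * D i (x k) - ((x k)⁻¹ * D i (x k)) ^ p := by
        rw [logDeriv_pow_char (D i) (hD i) _ (hx k)]; ring
      rw [h1, h1, map_sub, map_sub, derivation_pow_char, derivation_pow_char,
        logDeriv_closed D hcomm])
    (fun i _ => by
      have : p - 1 + (p - 1) = (p - 2) + p := by omega
      rw [← Module.End.mul_apply, ← pow_add, this, pow_add, Module.End.mul_apply, hD,
        show p - 1 = p - 2 + 1 by omega, pow_succ, Module.End.mul_apply]; rfl)
  choose h hh using hpot
  have h1 := det_sub_det_mem D τ (Matrix.of fun i k => (x k)⁻¹ * D (τ i) (x k))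
    (Matrix.of fun i k => ((x k)⁻¹ * D (τ i) (x k)) ^ p) h
    (fun k i j => logDeriv_closed D hcomm _ _ _)
    (fun k i j => by simp only [Matrix.of_apply]; rw [derivation_pow_char, derivation_pow_char])
    (fun i k => by
      rw [hh k (τ i) (Finset.mem_image_of_mem _ (Finset.mem_univ _)), Matrix.of_apply,
        Matrix.of_apply, logDeriv_pow_char (D (τ i)) (hD _) _ (hx k)])
  convert h1 using 2
  rw [← frobenius_def, RingHom.map_det]
  rfl

include hcomm in
/-- The coefficients of logarithmic forms are closed. -/
theorem sum_derivation_logDeriv_minor {n : ℕ} (ρ : Fin (n + 1) → I) (x : Fin n → F) :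
    ∑ i : Fin (n + 1), (-1) ^ (i : ℕ) * D (ρ i)
      (Matrix.of fun j k => (x k)⁻¹ * D (ρ (i.succAbove j)) (x k)).det = 0 := by
  let M : Matrix (Fin (n + 1)) (Fin (n + 1)) F :=
    Matrix.of fun i => Fin.cons 0 fun k => (x k)⁻¹ * D (ρ i) (x k)
  have h := sum_derivation_cramer D ρ M 0 fun k' hk i j => by
    obtain ⟨k, rfl⟩ := Fin.exists_succ_eq.2 hk
    exact logDeriv_closed D hcomm _ _ _
  rw [← h]
  refine Finset.sum_congr rfl fun i _ => ?_
  rw [Matrix.cramer_apply, Matrix.det_succ_column_zero, Finset.sum_eq_single i]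
  · have : ((M.updateCol 0 (Pi.single i 1)).submatrix i.succAbove Fin.succ) =
        (Matrix.of fun j k => (x k)⁻¹ * D (ρ (i.succAbove j)) (x k)) := by
      ext; simp [M]
    rw [this]
    rcases Nat.even_or_odd (i : ℕ) with he | he <;> simp [he.neg_one_pow]
  · intro j _ hj
    simp [hj]
  · simp

end CommutingDerivations

section LeadingCoefficient

variable {F : Type*} [Field F] {p : ℕ} [Fact p.Prime] [CharP F p] {I : Type*}
  (D : I → Derivation ℤ F F)

/-- The subfield of elements killed by all derivations with index in `T`. -/
def constantsSubfield (T : Set I) : Subfield F where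
  carrier := {x | ∀ i ∈ T, D i x = 0}
  mul_mem' ha hb i hi := by simp [Derivation.leibniz, ha i hi, hb i hi]
  one_mem' i _ := by simp
  add_mem' ha hb i hi := by simp [ha i hi, hb i hi]
  zero_mem' i _ := by simp
  neg_mem' ha i hi := by simp [ha i hi]
  inv_mem' a ha i hi := by simp [Derivation.leibniz_inv, ha i hi]

theorem mem_constantsSubfield {T : Set I} {x : F} :
    x ∈ constantsSubfield D T ↔ ∀ i ∈ T, D i x = 0 := Iff.rfl

include p in
omit [Fact p.Prime] in
theorem pow_mul_mem_derivationSpan {T : Set I} (x : F) {y : F} (hy : y ∈ derivationSpan D T) :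
    x ^ p * y ∈ derivationSpan D T := by
  refine AddSubgroup.closure_induction ?_ ?_ ?_ ?_ hy
  · rintro _ ⟨i, hi, z, rfl⟩
    have : x ^ p * D i z = D i (x ^ p * z) := by
      rw [Derivation.leibniz, derivation_pow_char]; simp
    rw [this]
    exact mem_derivationSpan D hi _
  · simp
  · intro a b _ _ ha hb
    rw [mul_add]; exact add_mem ha hb
  · intro a _ ha
    rw [mul_neg]; exact neg_mem ha

theorem derivationSpan_empty : derivationSpan D ∅ = ⊥ := by
  simp [derivationSpan]

variable (hcomm : ∀ i j x, D i (D j x) = D j (D i x))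
  (hD : ∀ i x, ((D i : F →ₗ[ℤ] F) ^ p) x = D i x)

include hcomm hD in
omit [CharP F p] in
theorem sub_pow_mem_derivationSpan {T T' : Set I} {m : I} (hT : ∀ i ∈ T, i = m ∨ i ∈ T') {y : F}
    (hy : y ∈ derivationSpan D T) :
    y - ((D m : F →ₗ[ℤ] F) ^ (p - 1)) y ∈ derivationSpan D T' := by
  refine AddSubgroup.closure_induction ?_ ?_ ?_ ?_ hy
  · rintro _ ⟨i, hi, z, rfl⟩
    rcases hT i hi with rfl | hi'
    · have : ((D i : F →ₗ[ℤ] F) ^ (p - 1)) (D i z) = D i z := by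
        rw [← hD i z]
        conv_rhs => rw [show p = p - 1 + 1 from (Nat.succ_pred_prime Fact.out).symm, pow_succ,
          Module.End.mul_apply]
        rw [hD i z]; rfl
      rw [this, sub_self]; exact zero_mem _
    · rw [← derivation_pow_comm D hcomm, ← map_sub]
      exact mem_derivationSpan D hi' _
  · simp
  · intro a b _ _ ha hb
    rw [map_add, add_sub_add_comm]; exact add_mem ha hb
  · intro a _ ha
    rw [map_neg, sub_neg_eq_add, neg_add_eq_sub, ← neg_sub]
    exact neg_mem ha

omit [CharP F p] in
theorem pow_pred_apply_eq_zero {m : I} {y : F} (hy : D m y = 0) :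
    ((D m : F →ₗ[ℤ] F) ^ (p - 1)) y = 0 := by
  have : p - 1 = (p - 2) + 1 := by have := (Fact.out : p.Prime).two_le; omega
  rw [this, pow_succ, Module.End.mul_apply]
  exact (congrArg _ hy).trans (map_zero _)

omit [CharP F p] in
include hcomm hD in
theorem eq_zero_of_mem_derivationSpan {n : ℕ} (s : Fin n → I) {y : F} (hy : ∀ i, D i y = 0)
    (h : y ∈ derivationSpan D (Set.range s)) : y = 0 := by
  induction n with
  | zero => simpa [derivationSpan_empty, Set.range_eq_empty] using h
  | succ n ih =>
    refine ih (fun k => s k.castSucc) ?_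
    have := sub_pow_mem_derivationSpan D hcomm hD (T' := Set.range fun k : Fin n => s k.castSucc)
      (m := s (Fin.last n)) (by
        rintro _ ⟨k, rfl⟩
        induction k using Fin.lastCases with
        | last => exact Or.inl rfl
        | cast k => exact Or.inr ⟨k, rfl⟩) h
    rwa [pow_pred_apply_eq_zero D (hy _), sub_zero] at this

theorem exists_zmod_of_pow_eq {y : F} (hy : y ^ p = y) : ∃ c : ZMod p, y = (c.cast : F) := by
  let _ : Algebra (ZMod p) F := ZMod.algebra F p
  have h := congrArg (Polynomial.aeval y) (prod_X_sub_C_zmod (p := p))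
  rw [map_prod] at h
  simp only [map_sub, map_pow, Polynomial.aeval_X, Polynomial.aeval_C, hy, sub_self] at h
  obtain ⟨c, -, hc⟩ := Finset.prod_eq_zero_iff.1 h
  exact ⟨c, sub_eq_zero.1 hc⟩

include hcomm hD in
/-- An element satisfying the closedness and Artin–Schreier conditions of a leading coefficient
is a product of logarithmic derivatives. -/
theorem exists_eq_prod_logDeriv [LinearOrder I] (b : I → F) (hb : ∀ i, b i ≠ 0)
    (hDb : ∀ i, D i (b i) = b i) (hDb' : ∀ i j, i ≠ j → D i (b j) = 0)
    (hF : ∀ x : F, ∃ y : F, y ^ (p - 1) = x)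
    {n : ℕ} (s : Fin n → I) (hs : StrictMono s) (y : F) (hy : y ≠ 0)
    (h1 : ∀ j, j ∉ Set.range s → D j y ∈ derivationSpan D {i | i ∈ Set.range s ∧ j < i})
    (h2 : y ^ p - y ∈ derivationSpan D (Set.range s)) :
    ∃ (x : Fin n → F) (c : ZMod p), (∀ k, x k ≠ 0 ∧ ∀ j, s k < j → D j (x k) = 0) ∧
      y = (c.cast : F) * ∏ k, (x k)⁻¹ * D (s k) (x k) := by
  have hp2 := (Fact.out : p.Prime).two_le
  have hp : p - 1 + 1 = p := by omega
  induction n generalizing y with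
  | zero =>
    rw [Set.range_eq_empty, derivationSpan_empty, AddSubgroup.mem_bot, sub_eq_zero] at h2
    obtain ⟨c, hc⟩ := exists_zmod_of_pow_eq h2
    exact ⟨Fin.elim0, c, fun k => k.elim0, by simp [hc]⟩
  | succ n ih =>
    set m := s (Fin.last n) with hm
    let s' : Fin n → I := fun k => s k.castSucc
    have hs' : StrictMono s' := hs.comp Fin.strictMono_castSucc
    have hs'm (k : Fin n) : s' k < m := hs (Fin.castSucc_lt_last k)
    have hrange (i : I) (hi : i ∈ Set.range s) : i = m ∨ i ∈ Set.range s' := by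
      obtain ⟨k, rfl⟩ := hi
      induction k using Fin.lastCases with
      | last => exact Or.inl rfl
      | cast k => exact Or.inr ⟨k, rfl⟩
    have hle (i : I) (hi : i ∈ Set.range s) : i ≤ m := by
      obtain ⟨k, rfl⟩ := hi
      exact hs.monotone (Fin.le_last k)
    have hyK (j : I) (hj : m < j) : D j y = 0 := by
      have := h1 j fun h => (hle j h).not_gt hj
      have he : {i | i ∈ Set.range s ∧ j < i} = ∅ := by
        ext i
        simp only [Set.mem_ofPred_eq, Set.mem_empty_iff_false, iff_false, not_and, not_lt]
        exact fun hi => (hle i hi).trans hj.le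
      rwa [he, derivationSpan_empty, AddSubgroup.mem_bot] at this
    set y0 := y - ((D m : F →ₗ[ℤ] F) ^ (p - 1)) y with hy0
    have hy0K (j : I) (hj : m < j) : D j y0 = 0 := by
      rw [hy0, map_sub, derivation_pow_comm D hcomm, hyK j hj, map_zero, sub_zero]
    have hy0m : D m y0 = 0 := by
      have : D m (((D m : F →ₗ[ℤ] F) ^ (p - 1)) y) = D m y := by
        rw [← hD m y]
        conv_rhs => rw [← hp, pow_succ', Module.End.mul_apply]
        rfl
      rw [hy0, map_sub, this, sub_self]
    have hart : y ^ p - y0 ∈ derivationSpan D (Set.range s') := by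
      have := sub_pow_mem_derivationSpan D hcomm hD hrange h2
      rwa [map_sub, pow_pred_apply_eq_zero D (derivation_pow_char (D m) y), zero_sub,
        sub_neg_eq_add, sub_add, ← hy0] at this
    have hy0ne : y0 ≠ 0 := by
      intro h
      rw [h, sub_zero] at hart
      exact pow_ne_zero p hy
        (eq_zero_of_mem_derivationSpan D hcomm hD s' (fun i => derivation_pow_char (D i) y) hart)
    obtain ⟨u, hu⟩ := hF (y0 / y ^ p)
    have hune : u ≠ 0 := by
      rintro rfl
      rw [zero_pow (by omega)] at hu
      exact (div_ne_zero hy0ne (pow_ne_zero p hy)) hu.symm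
    have huy : u * y0 = (u * y) ^ p := by
      have h3 : y0 = u ^ (p - 1) * y ^ p := by
        rw [hu, div_mul_cancel₀ _ (pow_ne_zero p hy)]
      rw [h3, mul_pow]
      conv_rhs => rw [← hp, pow_succ' u]
      rw [hp, mul_assoc]
    set v := u * y with hv
    have hvne : v ≠ 0 := mul_ne_zero hune hy
    have hu_inv : u⁻¹ = (v⁻¹) ^ p * y0 := by
      rw [inv_pow, ← huy, mul_inv, mul_assoc, inv_mul_cancel₀ hy0ne, mul_one]
    have hDu_inv (j : I) : D j u⁻¹ = (v⁻¹) ^ p * D j y0 := by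
      rw [hu_inv, Derivation.leibniz, derivation_pow_char]; simp
    have hDu (j : I) (hj : D j y0 = 0) : D j u = 0 := by
      have h3 := hDu_inv j
      rw [hj, mul_zero, Derivation.leibniz_inv] at h3
      simpa [hune] using h3
    have hDum (k : ℕ) : ((D m : F →ₗ[ℤ] F) ^ k) v = u * ((D m : F →ₗ[ℤ] F) ^ k) y := by
      induction k with
      | zero => rfl
      | succ k ih2 =>
        rw [pow_succ', Module.End.mul_apply, ih2, Module.End.mul_apply]
        change D m _ = u * D m _
        rw [Derivation.leibniz, hDu m hy0m]; simp
    obtain ⟨x, hxK, hx0, hx⟩ := exists_logDeriv_eq (D m) (hD m) (constantsSubfield D {j | m < j})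
      (fun z hz j hj => by rw [hcomm, hz j hj, map_zero]) (v := v) (b := b m)
      (fun j hj => by rw [hv, Derivation.leibniz, hyK j hj, hDu j (hy0K j hj)]; simp)
      (fun j hj => hDb' j m (ne_of_gt hj)) (hb m) (hDb m)
      (by rw [← huy, hDum, hy0, mul_sub])
    obtain ⟨x', c, hx', hc⟩ := ih s' hs' u⁻¹ (inv_ne_zero hune) (fun j hj => by
        rw [hDu_inv]
        refine pow_mul_mem_derivationSpan D _ ?_
        by_cases hjm : j = m
        · rw [hjm, hy0m]; exact zero_mem _
        · have hjs : j ∉ Set.range s := fun h => (hrange j h).elim hjm hj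
          rw [hy0, map_sub, derivation_pow_comm D hcomm]
          refine sub_pow_mem_derivationSpan D hcomm hD (fun i hi => ?_) (h1 j hjs)
          rcases hrange i hi.1 with h | h
          · exact Or.inl h
          · exact Or.inr ⟨h, hi.2⟩) (by
        have : u⁻¹ ^ p - u⁻¹ = (v⁻¹) ^ p * (y ^ p - y0) := by
          rw [mul_sub, ← hu_inv, ← mul_pow, hv, mul_inv, inv_mul_cancel_right₀ hy]
        rw [this]
        exact pow_mul_mem_derivationSpan D _ hart)
    refine ⟨Fin.snoc x' x, c, fun k => ?_, ?_⟩
    · induction k using Fin.lastCases with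
      | last => simpa using ⟨hx0, hxK⟩
      | cast k => simpa using hx' k
    · rw [Fin.prod_univ_castSucc]
      simp only [Fin.snoc_castSucc, Fin.snoc_last]
      rw [← mul_assoc, ← hc, ← hm, hx, hv]
      field_simp

end LeadingCoefficient

section PBasis

open IntermediateField Polynomial

variable {F : Type} [Field F] {p : ℕ} [Fact p.Prime] [CharP F p]

theorem minpoly_eq_X_pow_sub_C {L : Subfield F} {z : F} (hz : z ∉ L) {c : L}
    (hc : (c : F) = z ^ p) :
    minpoly L z = X ^ p - C c := by
  refine (minpoly.eq_of_irreducible_of_monic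
    (X_pow_sub_C_irreducible_of_prime Fact.out fun b hb => hz ?_) ?_
    (monic_X_pow_sub_C _ (Fact.out : p.Prime).ne_zero)).symm
  · have h1 : (z - (b : F)) ^ p = 0 := by
      rw [sub_pow_char, ← hc, ← hb]; simp
    rw [sub_eq_zero.1 (pow_eq_zero_iff (Fact.out : p.Prime).ne_zero |>.1 h1)]
    exact b.2
  · simp only [map_sub, map_pow, aeval_X, aeval_C, ← hc]
    exact sub_self _

/-- A derivation separating an element from a subfield containing all `p`-th powers. -/
theorem exists_derivation_ne_zero (K : Subfield F) (hK : ∀ x : F, x ^ p ∈ K) {x : F} (hx : x ∉ K) :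
    ∃ D : Derivation ℤ F F, (∀ y ∈ K, D y = 0) ∧ D x ≠ 0 := by
  obtain ⟨L, hKL, hL⟩ := zorn_le_nonempty₀ {L : Subfield F | x ∉ L} (fun c hc hchain M hM =>
    ⟨sSup c, fun h => by
      rw [Subfield.mem_sSup_of_directedOn ⟨M, hM⟩ hchain.directedOn] at h
      obtain ⟨N, hN, hxN⟩ := h
      exact hc hN hxN, fun N hN => le_sSup hN⟩) K hx
  have hxL : x ∉ L := hL.prop
  have hpL (z : F) : z ^ p ∈ L := hKL (hK z)
  have hmin (z : F) (hz : z ∉ L) : minpoly L z = X ^ p - C ⟨z ^ p, hpL z⟩ :=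
    minpoly_eq_X_pow_sub_C hz rfl
  have hint (z : F) : IsIntegral L z :=
    ⟨X ^ p - C ⟨z ^ p, hpL z⟩, monic_X_pow_sub_C _ (Fact.out : p.Prime).ne_zero, by
      rw [eval₂_sub, eval₂_X_pow, eval₂_C]
      exact sub_self _⟩
  have hfin (z : F) (hz : z ∉ L) : Module.finrank L L⟮z⟯ = p := by
    rw [adjoin.finrank (hint z), hmin z hz, natDegree_X_pow_sub_C]
  have htop : L⟮x⟯ = ⊤ := by
    refine eq_top_iff.2 fun z _ => ?_
    by_cases hz : z ∈ L
    · exact IntermediateField.algebraMap_mem L⟮x⟯ (⟨z, hz⟩ : L)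
    have hxz : x ∈ L⟮z⟯ := by
      by_contra hxz
      have hle : L ≤ L⟮z⟯.toSubfield := fun y hy =>
        IntermediateField.algebraMap_mem L⟮z⟯ (⟨y, hy⟩ : L)
      exact hz (hL.le_of_ge (y := L⟮z⟯.toSubfield) hxz hle (mem_adjoin_simple_self L z))
    have : FiniteDimensional L L⟮z⟯ := adjoin.finiteDimensional (hint z)
    rw [IntermediateField.eq_of_le_of_finrank_eq (adjoin_simple_le_iff.2 hxz)
      ((hfin x hxL).trans (hfin z hz).symm)]
    exact mem_adjoin_simple_self L z
  have hfd : FiniteDimensional L F := by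
    have : FiniteDimensional L (⊤ : IntermediateField L F) :=
      htop ▸ adjoin.finiteDimensional (hint x)
    exact Module.Finite.equiv (topEquiv (F := L) (E := F)).toLinearEquiv
  have hdx : KaehlerDifferential.D L F x ≠ 0 := by
    intro h0
    have hd (z : F) : KaehlerDifferential.D L F z = 0 := by
      have hz : z ∈ L⟮x⟯ := htop ▸ IntermediateField.mem_top
      induction hz using IntermediateField.adjoin_induction with
      | mem y hy => rw [Set.mem_singleton_iff.1 hy, h0]
      | algebraMap y => simp
      | add y z _ _ hy hz => rw [map_add, hy, hz, add_zero]
      | inv y _ hy => rw [Derivation.leibniz_inv, hy, smul_zero]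
      | mul y z _ _ hy hz => rw [Derivation.leibniz, hy, hz, smul_zero, smul_zero, add_zero]
    have hsub : Subsingleton (Ω[F⁄L]) := by
      have hspan := KaehlerDifferential.span_range_derivation L F
      have : Set.range (KaehlerDifferential.D L F) ⊆ {0} := by
        rintro _ ⟨z, rfl⟩; exact hd z
      refine subsingleton_of_forall_eq 0 fun w => ?_
      have hw : w ∈ Submodule.span F ({0} : Set (Ω[F⁄L])) :=
        Submodule.span_mono this (hspan ▸ Submodule.mem_top)
      simpa using hw
    have := (Algebra.formallyUnramified_iff L F).2 hsub
    have := Algebra.FormallyUnramified.isSeparable L F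
    have hs : (minpoly L x).Separable := Algebra.IsSeparable.isSeparable L x
    have hirr := minpoly.irreducible (hint x)
    rw [hmin x hxL] at hs hirr
    rw [separable_def] at hs
    have hp0 : ((p : ℕ) : L[X]) = 0 := by
      rw [← C_eq_natCast, CharP.cast_eq_zero L p, C_0]
    have hder : derivative (X ^ p - C (⟨x ^ p, hpL x⟩ : L)) = 0 := by
      rw [derivative_sub, derivative_X_pow, derivative_C, CharP.cast_eq_zero L p]; simp
    rw [hder, isCoprime_zero_right] at hs
    exact hirr.not_isUnit hs
  have hφ : ∃ φ : Module.Dual F (Ω[F⁄L]), φ (KaehlerDifferential.D L F x) ≠ 0 := by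
    by_contra! h
    exact hdx ((Module.forall_dual_apply_eq_zero_iff F _).1 h)
  obtain ⟨φ, hφ⟩ := hφ
  refine ⟨(φ.compDer (KaehlerDifferential.D L F)).restrictScalars ℤ, fun y hy => ?_, hφ⟩
  exact Derivation.map_algebraMap (φ.compDer (KaehlerDifferential.D L F)) (⟨y, hKL hy⟩ : L)

omit [CharP F p] in
theorem finrank_adjoin_finset_le (B : Subfield F) (hB : ∀ x : F, x ^ p ∈ B) (S : Finset F) :
    Module.finrank B (adjoin B (S : Set F)) ≤ p ^ S.card := by
  classical
  induction S using Finset.induction_on with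
  | empty =>
    rw [Finset.coe_empty, adjoin_empty, IntermediateField.finrank_bot, Finset.card_empty, pow_zero]
  | insert a S ha ih =>
    rw [Finset.coe_insert, Set.insert_eq, adjoin_union, Finset.card_insert_of_notMem ha, pow_succ']
    refine (finrank_sup_le _ _).trans (Nat.mul_le_mul ?_ ih)
    have hp0 := (Fact.out : p.Prime).ne_zero
    have hm : (X ^ p - C (⟨a ^ p, hB a⟩ : B)).Monic := monic_X_pow_sub_C _ hp0
    have ha : aeval a (X ^ p - C (⟨a ^ p, hB a⟩ : B)) = 0 := by
      simp only [map_sub, map_pow, aeval_X, aeval_C]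
      exact sub_self _
    rw [adjoin.finrank ⟨_, hm, ha⟩]
    refine (natDegree_le_of_dvd (minpoly.dvd B a ha) hm.ne_zero).trans ?_
    rw [natDegree_X_pow_sub_C]

omit [CharP F p] [Fact p.Prime] in
theorem pow_mem_pClosure (C : Set F) (x : F) : x ^ p ∈ pClosure F p C :=
  Subfield.subset_closure (Or.inl ⟨x, by simp⟩)

omit [CharP F p] [Fact p.Prime] in
theorem mem_pClosure {C : Set F} {x : F} (hx : x ∈ C) : x ∈ pClosure F p C :=
  Subfield.subset_closure (Or.inr hx)

omit [CharP F p] [Fact p.Prime] in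
theorem pClosure_le {C : Set F} {K : Subfield F} (hK : ∀ x, x ^ p ∈ K) (hC : C ⊆ K) :
    pClosure F p C ≤ K := by
  refine Subfield.closure_le.2 (Set.union_subset ?_ hC)
  rintro _ ⟨x, rfl⟩
  simpa using hK x

omit [CharP F p] in
theorem pIndep.notMem_pClosure {k : ℕ} {c : Fin k → F} (h : pIndep F p c) (j : Fin k) :
    c j ∉ pClosure F p (c '' {j}ᶜ) := by
  classical
  intro hj
  have h1 : adjoin (pClosure F p ∅) (Set.range c) =
      adjoin (pClosure F p ∅) ((({j}ᶜ : Finset (Fin k)).image c : Finset F) : Set F) := by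
    refine le_antisymm (adjoin_le_iff.2 ?_) (adjoin.mono _ _ _ ?_)
    · rintro _ ⟨i, rfl⟩
      by_cases hij : i = j
      · subst hij
        refine pClosure_le (K := (adjoin (pClosure F p ∅)
          ((({i}ᶜ : Finset (Fin k)).image c : Finset F) : Set F)).toSubfield) (fun x => ?_) ?_ hj
        · exact IntermediateField.algebraMap_mem (adjoin (pClosure F p ∅)
            ((({i}ᶜ : Finset (Fin k)).image c : Finset F) : Set F))
            (⟨x ^ p, pow_mem_pClosure _ x⟩ : pClosure F p (∅ : Set F))
        · refine Set.Subset.trans ?_ (subset_adjoin _ _)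
          simp
      · exact subset_adjoin _ _ (by simpa using ⟨i, hij, rfl⟩)
    · intro x hx
      simp only [Finset.coe_image, Set.mem_image] at hx
      obtain ⟨i, -, rfl⟩ := hx
      exact ⟨i, rfl⟩
  have h2 : Module.finrank (pClosure F p ∅) (adjoin (pClosure F p ∅) (Set.range c)) = p ^ k := h
  rw [h1] at h2
  have h3 := finrank_adjoin_finset_le (p := p) (pClosure F p ∅) (pow_mem_pClosure _)
    (({j}ᶜ : Finset (Fin k)).image c)
  rw [h2] at h3
  have h4 := (Nat.pow_le_pow_iff_right (Fact.out : p.Prime).one_lt).1 h3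
  have h5 := h4.trans Finset.card_image_le
  rw [Finset.card_compl, Finset.card_singleton, Fintype.card_fin] at h5
  have := j.pos
  omega

theorem pIndep.linearIndependent {k : ℕ} {c : Fin k → F} (h : pIndep F p c) :
    LinearIndependent F fun j => KaehlerDifferential.D ℤ F (c j) := by
  rw [Fintype.linearIndependent_iff]
  intro g hg j
  obtain ⟨δ, hδ, hδj⟩ := exists_derivation_ne_zero (p := p) _ (pow_mem_pClosure _)
    (h.notMem_pClosure j)
  have h1 := congrArg δ.liftKaehlerDifferential hg
  simp only [map_sum, map_smul, Derivation.liftKaehlerDifferential_comp_D, map_zero,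
    smul_eq_mul] at h1
  rw [Finset.sum_eq_single j (fun i _ hi => by
    rw [hδ (c i) (mem_pClosure ⟨i, hi, rfl⟩), mul_zero]) (by simp)] at h1
  exact (mul_eq_zero.1 h1).resolve_right hδj

section LogBasis

variable {I : Type} (B : Module.Basis I F Ω[F⁄ℤ])

/-- The derivation obtained by taking the coefficient of a differential along a basis vector. -/
noncomputable def coordDerivation (i : I) : Derivation ℤ F F :=
  (B.coord i).compDer (KaehlerDifferential.D ℤ F)

theorem coordDerivation_apply (i : I) (x : F) :
    coordDerivation B i x = B.repr (KaehlerDifferential.D ℤ F x) i := rfl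

variable {b : I → F} (hB : ∀ i, B i = (b i)⁻¹ • KaehlerDifferential.D ℤ F (b i))

include hB in
theorem logBasis_ne_zero (i : I) : b i ≠ 0 := by
  intro h
  apply B.ne_zero i
  rw [hB, h, inv_zero, zero_smul]

include hB in
theorem coordDerivation_self (i : I) : coordDerivation B i (b i) = b i := by
  have h : KaehlerDifferential.D ℤ F (b i) = b i • B i := by
    rw [hB, smul_inv_smul₀ (logBasis_ne_zero B hB i)]
  rw [coordDerivation_apply, h]; simp

include hB in
theorem coordDerivation_of_ne {i j : I} (hij : i ≠ j) : coordDerivation B i (b j) = 0 := by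
  have h : KaehlerDifferential.D ℤ F (b j) = b j • B j := by
    rw [hB, smul_inv_smul₀ (logBasis_ne_zero B hB j)]
  rw [coordDerivation_apply, h]; simp [hij.symm]

include hB in
theorem derivation_eq_zero_of_logBasis (δ : Derivation ℤ F F) (h : ∀ i, δ (b i) = 0) (x : F) :
    δ x = 0 := by
  have h1 : δ.liftKaehlerDifferential = 0 := B.ext fun i => by
    rw [hB, map_smul, Derivation.liftKaehlerDifferential_comp_D, h]; simp
  rw [← Derivation.liftKaehlerDifferential_comp_D δ x, h1]; rfl

include hB in
theorem coordDerivation_comm (i j : I) (x : F) :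
    coordDerivation B i (coordDerivation B j x) = coordDerivation B j (coordDerivation B i x) := by
  have h := derivation_eq_zero_of_logBasis B hB ⁅coordDerivation B i, coordDerivation B j⁆
    (fun k => by
      rw [Derivation.commutator_apply]
      by_cases hik : i = k <;> by_cases hjk : j = k
      · subst hik; subst hjk; simp
      · subst hik
        rw [coordDerivation_of_ne B hB hjk, coordDerivation_self B hB,
          coordDerivation_of_ne B hB hjk]; simp
      · subst hjk
        rw [coordDerivation_of_ne B hB hik, coordDerivation_self B hB,
          coordDerivation_of_ne B hB hik]; simp
      · rw [coordDerivation_of_ne B hB hjk, coordDerivation_of_ne B hB hik]; simp) x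
  rw [Derivation.commutator_apply] at h
  exact sub_eq_zero.1 h

include hB in
theorem coordDerivation_pow (i : I) (x : F) :
    ((coordDerivation B i : F →ₗ[ℤ] F) ^ p) x = coordDerivation B i x := by
  have h := derivation_eq_zero_of_logBasis B hB
    (derivationPow p (coordDerivation B i) - coordDerivation B i) (fun k => by
      rw [Derivation.sub_apply, derivationPow_apply]
      by_cases hik : i = k
      · subst hik
        have (n : ℕ) : ((coordDerivation B i : F →ₗ[ℤ] F) ^ n) (b i) = b i := by
          induction n with
          | zero => rfl
          | succ n ih =>
            rw [pow_succ', Module.End.mul_apply, ih]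
            exact coordDerivation_self B hB i
        rw [this, coordDerivation_self B hB, sub_self]
      · rw [show p = p - 1 + 1 from (Nat.succ_pred_prime Fact.out).symm, pow_succ,
          Module.End.mul_apply]
        have h0 := coordDerivation_of_ne B hB hik
        rw [h0, sub_zero]
        exact (congrArg _ h0).trans (map_zero _)) x
  rw [Derivation.sub_apply, derivationPow_apply] at h
  exact sub_eq_zero.1 h

include hB in
theorem mem_pClosure_of_coordDerivation_eq_zero (T : Set I) {x : F}
    (hx : ∀ i ∉ T, coordDerivation B i x = 0) : x ∈ pClosure F p (b '' T) := by
  by_contra hxT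
  obtain ⟨δ, hδ, hδx⟩ := exists_derivation_ne_zero (p := p) _ (pow_mem_pClosure _) hxT
  apply hδx
  rw [← Derivation.liftKaehlerDifferential_comp_D δ x,
    ← B.linearCombination_repr (KaehlerDifferential.D ℤ F x), Finsupp.linearCombination_apply,
    Finsupp.sum, map_sum]
  refine Finset.sum_eq_zero fun i _ => ?_
  rw [map_smul]
  by_cases hi : i ∈ T
  · rw [hB, map_smul, Derivation.liftKaehlerDifferential_comp_D,
      hδ (b i) (mem_pClosure ⟨i, hi, rfl⟩), smul_zero, smul_zero]
  · rw [← coordDerivation_apply, hx i hi, zero_smul]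

end LogBasis

/-- A `p`-independent family extends to a well-ordered `p`-basis in which it forms an initial
segment. -/
theorem pIndep.exists_logBasis {k : ℕ} {c : Fin k → F} (h : pIndep F p c) :
    ∃ (I : Type) (_ : LinearOrder I) (_ : WellFoundedLT I) (b : I → F)
      (B : Module.Basis I F Ω[F⁄ℤ]) (ι : Fin k → I),
      (∀ i, B i = (b i)⁻¹ • KaehlerDifferential.D ℤ F (b i)) ∧ StrictMono ι ∧
      (∀ j, b (ι j) = c j) ∧ ∀ i j, i < ι j → i ∈ Set.range ι := by
  classical
  have hli := h.linearIndependent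
  have hinj : Function.Injective c := fun i j hij => hli.injective (congrArg _ hij)
  have hOn : LinearIndepOn F (KaehlerDifferential.D ℤ F) (Set.range c) :=
    (linearIndepOn_range_iff hinj _).2 hli
  obtain ⟨S, -, hcS, hspan, hS⟩ := exists_linearIndepOn_extension hOn (Set.subset_univ _)
  have hS' : ⊤ ≤ Submodule.span F (Set.range fun x : S => KaehlerDifferential.D ℤ F x) := by
    rw [← KaehlerDifferential.span_range_derivation ℤ F]
    refine Submodule.span_le.2 ?_
    rw [Set.image_univ] at hspan
    refine hspan.trans_eq ?_
    congr 2
    ext; simp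
  let B0 : Module.Basis S F Ω[F⁄ℤ] := Module.Basis.mk hS hS'
  have hB0 (x : S) : B0 x = KaehlerDifferential.D ℤ F x := Module.Basis.mk_apply hS hS' x
  have hne (x : S) : (x : F) ≠ 0 := by
    intro h0
    apply B0.ne_zero x
    rw [hB0, h0, map_zero]
  let rank : S → ℕ := fun x => if hx : ∃ j, c j = x then (hx.choose : ℕ) else k
  have hrank (j : Fin k) (hj : c j ∈ S) : rank ⟨c j, hj⟩ = j := by
    have hx : ∃ j', c j' = c j := ⟨j, rfl⟩
    simp only [rank, dif_pos hx]
    rw [hinj hx.choose_spec]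
  let key : S → ℕ ×ₗ Cardinal.{0} := fun x => toLex (rank x, embeddingToCardinal (x : F))
  have hkey : Function.Injective key := fun x y hxy => by
    have := congrArg (fun z => (ofLex z).2) hxy
    exact Subtype.ext (embeddingToCardinal.injective this)
  let ord : LinearOrder S := LinearOrder.lift' key hkey
  have hlt (x y : S) : x < y ↔ key x < key y := Iff.rfl
  refine ⟨S, ord, ⟨InvImage.wf key wellFounded_lt⟩, Subtype.val,
    B0.unitsSMul fun x => (Units.mk0 (x : F) (hne x))⁻¹, fun j => ⟨c j, hcS ⟨j, rfl⟩⟩, fun x => ?_,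
    fun i j hij => ?_, fun _ => rfl, fun x j hx => ?_⟩
  · rw [Module.Basis.unitsSMul_apply, hB0, Units.smul_def, Units.val_inv_eq_inv_val, Units.val_mk0]
  · rw [hlt, Prod.Lex.lt_iff]
    left
    change rank _ < rank _
    rw [hrank, hrank]
    exact hij
  · rw [hlt, Prod.Lex.lt_iff] at hx
    have h1 : rank x ≤ j := by
      have h2 := hrank j (hcS ⟨j, rfl⟩)
      rcases hx with hx | hx
      · exact (le_of_lt hx).trans_eq h2
      · exact (le_of_eq hx.1).trans_eq h2
    have h3 : ∃ j, c j = x := by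
      by_contra hn
      simp only [rank, dif_neg hn] at h1
      exact absurd h1 (by omega)
    obtain ⟨i, hi⟩ := h3
    exact ⟨i, Subtype.ext hi⟩

end PBasis

section Minors

variable {R M I : Type*} [CommRing R] [AddCommGroup M] [Module R M] (B : Module.Basis I R M) {n : ℕ}

/-- The linear map of coordinates along a family of basis vectors. -/
noncomputable def tupleCoords (τ : Fin n → I) : M →ₗ[R] (Fin n → R) :=
  LinearMap.pi fun i => B.coord (τ i)

theorem tupleCoords_apply (τ : Fin n → I) (v : M) (i : Fin n) :
    tupleCoords B τ v i = B.repr v (τ i) := rfl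

/-- The coefficient of a form along the exterior product of a family of basis vectors. -/
noncomputable def minor (τ : Fin n → I) : ExteriorAlgebra R M →ₗ[R] R :=
  ExteriorAlgebra.liftAlternating
      (Pi.single (M := fun i => (Fin n → R) [⋀^Fin i]→ₗ[R] R) n Matrix.detRowAlternating) ∘ₗ
    (ExteriorAlgebra.map (tupleCoords B τ)).toLinearMap

theorem minor_ιMulti (τ : Fin n → I) (v : Fin n → M) :
    minor B τ (ExteriorAlgebra.ιMulti R n v) =
      (Matrix.of fun i k => B.repr (v k) (τ i)).det := by
  rw [minor, LinearMap.comp_apply, AlgHom.toLinearMap_apply, ExteriorAlgebra.map_apply_ιMulti,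
    ExteriorAlgebra.liftAlternating_apply_ιMulti, Pi.single_eq_same, ← Matrix.det_transpose]
  rfl

theorem minor_ιMulti_of_ne {m : ℕ} (hm : m ≠ n) (τ : Fin n → I) (v : Fin m → M) :
    minor B τ (ExteriorAlgebra.ιMulti R m v) = 0 := by
  rw [minor, LinearMap.comp_apply, AlgHom.toLinearMap_apply, ExteriorAlgebra.map_apply_ιMulti,
    ExteriorAlgebra.liftAlternating_apply_ιMulti, Pi.single_eq_of_ne hm]
  rfl

theorem minor_comp_perm (τ : Fin n → I) (σ : Equiv.Perm (Fin n)) :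
    minor B (τ ∘ σ) = ((Equiv.Perm.sign σ : ℤ) : R) • minor B τ := by
  refine ExteriorAlgebra.lhom_ext (R := R) fun m => AlternatingMap.ext fun v => ?_
  simp only [LinearMap.compAlternatingMap_apply, LinearMap.smul_apply]
  by_cases hm : m = n
  · subst hm
    rw [minor_ιMulti, minor_ιMulti]
    exact Matrix.det_permute σ (Matrix.of fun i k => B.repr (v k) (τ i))
  · rw [minor_ιMulti_of_ne B hm, minor_ιMulti_of_ne B hm, smul_zero]

theorem minor_ιMulti_mul_eq_zero {t : ℕ} (τ : Fin n → I) (v : Fin t → M)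
    (h : ExteriorAlgebra.ιMulti R t (tupleCoords B τ ∘ v) = 0) (w : ExteriorAlgebra R M) :
    minor B τ (ExteriorAlgebra.ιMulti R t v * w) = 0 := by
  rw [minor, LinearMap.comp_apply, AlgHom.toLinearMap_apply, map_mul,
    ExteriorAlgebra.map_apply_ιMulti, h, zero_mul, map_zero]

end Minors

section MinorsField

variable {F M I : Type*} [Field F] [AddCommGroup M] [Module F M] [LinearOrder I]
  (B : Module.Basis I F M) {n : ℕ}

/-- The first `t` terms of a finite sequence exist and lie in `T`. -/
def InitialIn (T : Set I) (t : ℕ) (s : Fin n → I) : Prop :=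
  t ≤ n ∧ ∀ k : Fin n, (k : ℕ) < t → s k ∈ T

theorem initialIn_of_minor_ne_zero {T : Set I} (hT : IsLowerSet T) {t : ℕ} {s : Fin n → I}
    (hs : StrictMono s) (v : Fin t → M) (hv : ∀ k, ∀ i ∉ T, B.repr (v k) i = 0)
    {w : ExteriorAlgebra F M} (h : minor B s (ExteriorAlgebra.ιMulti F t v * w) ≠ 0) :
    InitialIn T t s := by
  classical
  let J := {k : Fin n // s k ∈ T}
  have hli : LinearIndependent F (tupleCoords B s ∘ v) := by
    by_contra hli
    exact h (minor_ιMulti_mul_eq_zero B s v (AlternatingMap.map_linearDependent _ _ hli) w)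
  have hJ : t ≤ Fintype.card J := by
    have h1 : tupleCoords B s ∘ v = Function.ExtendByZero.linearMap F (Subtype.val : J → Fin n) ∘
        fun k => (fun j : J => B.repr (v k) (s j)) := by
      funext k
      funext i
      simp only [Function.comp_apply, tupleCoords_apply, Function.ExtendByZero.linearMap_apply]
      by_cases hi : s i ∈ T
      · exact (Subtype.val_injective.extend_apply (fun j : J => B.repr (v k) (s j)) 0
          (⟨i, hi⟩ : J)).symm
      · rw [hv k _ hi, Function.extend_apply' _ _ _ (fun ⟨j, hj⟩ => hi (hj ▸ j.2))]
        rfl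
    rw [h1] at hli
    simpa using (LinearIndependent.of_comp _ hli).fintype_card_le_finrank
  refine ⟨hJ.trans (by simpa using Fintype.card_subtype_le fun k => s k ∈ T), fun k hk => ?_⟩
  by_contra hkT
  have h2 : Fintype.card J ≤ Fintype.card (Fin k) := by
    refine Fintype.card_le_of_injective (fun j : J => (⟨j.1, ?_⟩ : Fin k)) fun i j hij => ?_
    · by_contra hjk
      exact hkT (hT (hs.monotone (not_lt.1 hjk)) j.2)
    · exact Subtype.ext (Fin.ext (Fin.mk.inj hij))
  rw [Fintype.card_fin] at h2
  omega

theorem exteriorPower_repr_apply {ω : ExteriorAlgebra F M} (hω : ω ∈ ⋀[F]^n M)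
    (s : Set.powersetCard I n) :
    (B.exteriorPower n).repr ⟨ω, hω⟩ s = minor B (Set.powersetCard.ofFinEmbEquiv.symm s) ω := by
  have h : (B.exteriorPower n).coord s =
      minor B (Set.powersetCard.ofFinEmbEquiv.symm s) ∘ₗ Submodule.subtype _ := by
    rw [exteriorPower.basis_coord]
    refine exteriorPower.linearMap_ext (AlternatingMap.ext fun v => ?_)
    simp only [LinearMap.compAlternatingMap_apply]
    rw [exteriorPower.ιMultiDual_apply_ιMulti, ← Matrix.det_transpose]
    exact (minor_ιMulti B _ v).symm
  exact LinearMap.congr_fun h ⟨ω, hω⟩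

theorem mem_of_minor {ω : ExteriorAlgebra F M} (hω : ω ∈ ⋀[F]^n M)
    (W : Submodule F (ExteriorAlgebra F M))
    (h : ∀ s : Fin n → I, StrictMono s → minor B s ω ≠ 0 →
      ExteriorAlgebra.ιMulti F n (B ∘ s) ∈ W) : ω ∈ W := by
  have h1 := (B.exteriorPower n).linearCombination_repr ⟨ω, hω⟩
  have h2 := congrArg (Submodule.subtype _) h1
  rw [Finsupp.linearCombination_apply, Finsupp.sum, map_sum] at h2
  rw [← show _ = ω from h2]
  refine Submodule.sum_mem _ fun s hs => ?_
  rw [map_smul, exteriorPower.basis_apply]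
  refine Submodule.smul_mem _ _ (h _ (Set.powersetCard.ofFinEmbEquiv.symm s).strictMono ?_)
  rw [← exteriorPower_repr_apply B hω]
  exact Finsupp.mem_support_iff.1 hs

theorem exists_max_minor {ω : ExteriorAlgebra F M} (hω : ω ∈ ⋀[F]^n M)
    (h0 : ω ≠ 0) : ∃ s : Fin n → I, StrictMono s ∧ minor B s ω ≠ 0 ∧
      ∀ s' : Fin n → I, StrictMono s' → minor B s' ω ≠ 0 → toColex s' ≤ toColex s := by
  have hne : ((B.exteriorPower n).repr ⟨ω, hω⟩).support.Nonempty := by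
    rw [Finsupp.support_nonempty_iff]
    intro h
    exact h0 (congrArg Subtype.val ((B.exteriorPower n).repr.map_eq_zero_iff.1 h))
  obtain ⟨s, hs, hmax⟩ := Finset.exists_max_image _
    (fun s => toColex (⇑(Set.powersetCard.ofFinEmbEquiv.symm s) : Fin n → I)) hne
  refine ⟨_, (Set.powersetCard.ofFinEmbEquiv.symm s).strictMono, ?_, fun s' hs' h' => ?_⟩
  · rw [← exteriorPower_repr_apply B hω]
    exact Finsupp.mem_support_iff.1 hs
  · have h2 := hmax (Set.powersetCard.ofFinEmbEquiv (OrderEmbedding.ofStrictMono s' hs'))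
    rw [Finsupp.mem_support_iff, exteriorPower_repr_apply, Equiv.symm_apply_apply] at h2
    exact h2 h'

theorem Matrix.det_eq_zero_of_card_lt {m : Type*} [Fintype m] [DecidableEq m] (A : Matrix m m F)
    (r c : Finset m) (hrc : c.card < r.card) (h : ∀ i ∈ r, ∀ k ∉ c, A i k = 0) : A.det = 0 := by
  rw [Matrix.det_apply]
  refine Finset.sum_eq_zero fun σ _ => ?_
  obtain ⟨i, hi, hic⟩ : ∃ i ∈ r, σ.symm i ∉ c := by
    by_contra! hn
    exact absurd (Finset.card_le_card_of_injOn σ.symm hn σ.symm.injective.injOn) (by omega)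
  rw [Finset.prod_eq_zero (Finset.mem_univ (σ.symm i)), smul_zero]
  rw [Equiv.apply_symm_apply]
  exact h i hi _ hic

end MinorsField

section LogForms

variable {F : Type} [Field F] {p : ℕ} [Fact p.Prime] [CharP F p] {I : Type}
  (B : Module.Basis I F Ω[F⁄ℤ]) {n : ℕ}

omit [Fact p.Prime] [CharP F p] in
theorem minor_logForm (τ : Fin n → I) (x : Fin n → F) :
    minor B τ (logForm F x) =
      (Matrix.of fun i k => (x k)⁻¹ * coordDerivation B (τ i) (x k)).det := by
  rw [logForm, ← ExteriorAlgebra.ιMulti_apply, minor_ιMulti]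
  simp [coordDerivation_apply]

theorem nuPow_natCast_induction {P : ExtOmega F → Prop} {ω : ExtOmega F} (hω : ω ∈ nuPow F n)
    (h : ∀ x : Fin n → F, (∀ i, x i ≠ 0) → P (logForm F x)) (h0 : P 0)
    (hadd : ∀ α β, P α → P β → P (α + β)) (hneg : ∀ α, P α → P (-α)) : P ω := by
  rw [nuPow, if_pos (Int.natCast_nonneg n)] at hω
  induction hω using AddSubgroup.closure_induction with
  | mem α hα =>
    obtain ⟨x, hx, rfl⟩ := hα
    exact h x hx
  | zero => exact h0
  | add α β _ _ hα hβ => exact hadd α β hα hβ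
  | neg α _ hα => exact hneg α hα

theorem logForm_mem_nuPow {x : Fin n → F} (hx : ∀ i, x i ≠ 0) : logForm F x ∈ nuPow F n := by
  rw [nuPow, if_pos (Int.natCast_nonneg n)]
  exact AddSubgroup.subset_closure ⟨x, hx, rfl⟩

theorem OmegaPow_natCast : OmegaPow F n = ⋀[F]^n (Ω[F⁄ℤ]) :=
  if_pos (Int.natCast_nonneg n)

theorem nuPow_natCast_le {ω : ExtOmega F} (hω : ω ∈ nuPow F n) : ω ∈ ⋀[F]^n (Ω[F⁄ℤ]) := by
  refine nuPow_natCast_induction hω (fun x _ => ?_) (zero_mem _) (fun _ _ => add_mem)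
    fun _ => neg_mem
  rw [logForm, ← ExteriorAlgebra.ιMulti_apply]
  exact ExteriorAlgebra.ιMulti_range F n ⟨_, rfl⟩

variable {b : I → F} (hB : ∀ i, B i = (b i)⁻¹ • KaehlerDifferential.D ℤ F (b i))

include hB in
theorem sum_coordDerivation_minor (ρ : Fin (n + 1) → I) {ω : ExtOmega F} (hω : ω ∈ nuPow F n) :
    ∑ i : Fin (n + 1), (-1) ^ (i : ℕ) *
      coordDerivation B (ρ i) (minor B (ρ ∘ i.succAbove) ω) = 0 := by
  refine nuPow_natCast_induction (P := fun ω => ∑ i : Fin (n + 1), (-1) ^ (i : ℕ) *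
    coordDerivation B (ρ i) (minor B (ρ ∘ i.succAbove) ω) = 0) hω (fun x _ => ?_) (by simp)
    (fun α β hα hβ => ?_) fun α hα => ?_
  · simp only [minor_logForm]
    exact sum_derivation_logDeriv_minor _ (coordDerivation_comm B hB) ρ x
  · simp only [map_add, mul_add, Finset.sum_add_distrib, hα, hβ, add_zero]
  · simp only [map_neg, mul_neg, Finset.sum_neg_distrib, hα, neg_zero]

include hB in
theorem minor_pow_sub_mem (τ : Fin n → I) {ω : ExtOmega F} (hω : ω ∈ nuPow F n) :
    minor B τ ω ^ p - minor B τ ω ∈ derivationSpan (coordDerivation B) (Set.range τ) := by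
  refine nuPow_natCast_induction (P := fun ω => minor B τ ω ^ p - minor B τ ω ∈
    derivationSpan (coordDerivation B) (Set.range τ)) hω (fun x hx => ?_) ?_
    (fun α β hα hβ => ?_) fun α hα => ?_
  · rw [minor_logForm]
    exact logDeriv_det_pow_sub_mem _ (coordDerivation_comm B hB) (coordDerivation_pow B hB) τ x hx
  · rw [map_zero, zero_pow (Fact.out : p.Prime).ne_zero, sub_zero]
    exact zero_mem _
  · rw [map_add, add_pow_char, add_sub_add_comm]
    exact add_mem hα hβ
  · have : (-minor B τ α) ^ p = -minor B τ α ^ p := by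
      have := sub_pow_char (p := p) (0 : F) (minor B τ α)
      rwa [zero_sub, zero_pow (Fact.out : p.Prime).ne_zero, zero_sub] at this
    rw [map_neg, this, ← neg_sub']
    exact neg_mem hα

variable [LinearOrder I]

theorem minor_logForm_eq_zero {s σ : Fin n → I} (hs : Monotone s) (hσ : Monotone σ)
    (hle : ¬ σ ≤ s) {x : Fin n → F} (hx : ∀ k j, s k < j → coordDerivation B j (x k) = 0) :
    minor B σ (logForm F x) = 0 := by
  rw [Pi.le_def] at hle
  push Not at hle
  obtain ⟨i, hi⟩ := hle
  rw [minor_logForm]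
  refine Matrix.det_eq_zero_of_card_lt _ (Finset.Ici i) (Finset.Ioi i) (by simp; omega)
    fun j hj k hk => ?_
  rw [Matrix.of_apply, hx k, mul_zero]
  exact ((hs (by simpa using hk)).trans_lt hi).trans_le (hσ (Finset.mem_Ici.1 hj))

theorem minor_logForm_self {s : Fin n → I} (hs : StrictMono s) {x : Fin n → F}
    (hx : ∀ k j, s k < j → coordDerivation B j (x k) = 0) :
    minor B s (logForm F x) = ∏ k, (x k)⁻¹ * coordDerivation B (s k) (x k) := by
  rw [minor_logForm, Matrix.det_of_isUpperTriangular]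
  · rfl
  · intro i j hij
    rw [Matrix.of_apply, hx j (s i) (hs hij), mul_zero]

/-- Replacing one term of a strictly increasing sequence by a larger element and sorting the
result increases the sequence. -/
theorem lt_of_replace {s τ : Fin n → I} (hs : StrictMono s) (hτ : StrictMono τ) {j : I}
    (hj : j ∉ Set.range s) (hjτ : j ∈ Set.range τ) {k : Fin n} (hk : s k < j)
    (h : ∀ i, τ i = j ∨ ∃ m, m ≠ k ∧ τ i = s m) : s < τ := by
  refine lt_of_le_of_ne (fun i => ?_) fun h => hj (h ▸ hjτ)
  by_contra! hi
  have h1 (i' : Fin n) : ∃ m, (τ i' = j ∧ m = k) ∨ (m ≠ k ∧ τ i' = s m) := by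
    rcases h i' with h | ⟨m, hm⟩
    · exact ⟨k, Or.inl ⟨h, rfl⟩⟩
    · exact ⟨m, Or.inr hm⟩
  choose f hf using h1
  have h2 : (Finset.Iic i).card ≤ (Finset.Iio i).card := by
    refine Finset.card_le_card_of_injOn f (fun m hm => ?_) fun m _ m' _ hmm => ?_
    · have h3 := (hτ.monotone (Finset.mem_Iic.1 (Finset.mem_coe.1 hm))).trans_lt hi
      rw [Finset.coe_Iio, Set.mem_Iio]
      rcases hf m with ⟨h4, h5⟩ | ⟨-, h5⟩
      · rw [h5]
        exact hs.lt_iff_lt.1 (hk.trans (h4 ▸ h3))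
      · exact hs.lt_iff_lt.1 (h5 ▸ h3)
    · refine hτ.injective ?_
      rcases hf m with ⟨h4, h5⟩ | ⟨h4, h5⟩ <;> rcases hf m' with ⟨h6, h7⟩ | ⟨h6, h7⟩
      · rw [h4, h6]
      · exact absurd (hmm ▸ h5) h6
      · exact absurd (hmm ▸ h7) h4
      · rw [h5, h7, hmm]
  simp at h2

include hB in
theorem coordDerivation_minor_mem {s : Fin n → I} (hs : StrictMono s) {ω : ExtOmega F}
    (hω : ω ∈ nuPow F n) (hmax : ∀ τ, StrictMono τ → s < τ → minor B τ ω = 0) {j : I}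
    (hj : j ∉ Set.range s) : coordDerivation B j (minor B s ω) ∈
      derivationSpan (coordDerivation B) {i | i ∈ Set.range s ∧ j < i} := by
  have h := sum_coordDerivation_minor B hB (Fin.cons j s : Fin (n + 1) → I) hω
  have hinj : Function.Injective (Fin.cons j s : Fin (n + 1) → I) :=
    Fin.cons_injective_iff.2 ⟨hj, hs.injective⟩
  rw [Fin.sum_univ_succ] at h
  simp only [Fin.cons_zero, Fin.cons_succ, Fin.val_zero, pow_zero, one_mul] at h
  have h0 : (Fin.cons j s : Fin (n + 1) → I) ∘ (0 : Fin (n + 1)).succAbove = s := by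
    funext i; simp
  rw [h0] at h
  rw [eq_neg_of_add_eq_zero_left h]
  refine neg_mem (sum_mem fun k _ => ?_)
  have hsgn (m : ℕ) (z : F) : (-1) ^ m * coordDerivation B (s k) z =
      coordDerivation B (s k) ((-1) ^ m * z) := by
    rcases neg_one_pow_eq_or F m with hm | hm <;> simp [hm]
  rw [hsgn]
  rcases lt_trichotomy j (s k) with hjk | hjk | hjk
  · exact mem_derivationSpan _
      (show s k ∈ {i | i ∈ Set.range s ∧ j < i} from ⟨⟨k, rfl⟩, hjk⟩) _
  · exact absurd ⟨k, hjk.symm⟩ hj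
  set τ := (Fin.cons j s : Fin (n + 1) → I) ∘ k.succ.succAbove with hτ
  have hτinj : Function.Injective τ := hinj.comp Fin.succAbove_right_injective
  have hsort : StrictMono (τ ∘ Tuple.sort τ) :=
    (Tuple.monotone_sort τ).strictMono_of_injective (hτinj.comp (Tuple.sort τ).injective)
  have h1 := hmax _ hsort (lt_of_replace hs hsort hj ?_ hjk fun i => ?_)
  · have h2 : minor B τ ω = 0 := by
      rw [minor_comp_perm, LinearMap.smul_apply, smul_eq_mul] at h1
      refine (mul_eq_zero.1 h1).resolve_left ?_
      rcases Int.units_eq_one_or (Equiv.Perm.sign (Tuple.sort τ)) with h3 | h3 <;> simp [h3]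
    rw [h2, mul_zero, map_zero]
    exact zero_mem _
  · obtain ⟨i, hi⟩ := Fin.exists_succAbove_eq (Fin.succ_ne_zero k).symm
    exact ⟨(Tuple.sort τ).symm i, by simp [hτ, hi]⟩
  · have h2 := Fin.succAbove_ne k.succ (Tuple.sort τ i)
    simp only [hτ, Function.comp_apply]
    induction h3 : k.succ.succAbove (Tuple.sort τ i) using Fin.cases with
    | zero => exact Or.inl rfl
    | succ m =>
      refine Or.inr ⟨m, fun hm => h2 ?_, rfl⟩
      rw [h3, hm]

include hB in
/-- The leading term of an element of `ν_n` is the leading term of a multiple of a logarithmic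
form with suitable entries. -/
theorem exists_logForm_minor_eq (hF : ∀ x : F, ∃ y : F, y ^ (p - 1) = x) {s : Fin n → I}
    (hs : StrictMono s) {ω : ExtOmega F} (hω : ω ∈ nuPow F n) (h0 : minor B s ω ≠ 0)
    (hmax : ∀ τ, StrictMono τ → s < τ → minor B τ ω = 0) :
    ∃ (x : Fin n → F) (c : ℕ), (∀ k, x k ≠ 0 ∧ ∀ j, s k < j → coordDerivation B j (x k) = 0) ∧
      minor B s ω = minor B s (c • logForm F x) := by
  obtain ⟨x, c, hx, hc⟩ := exists_eq_prod_logDeriv (coordDerivation B) (coordDerivation_comm B hB)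
    (coordDerivation_pow B hB) b (logBasis_ne_zero B hB) (coordDerivation_self B hB)
    (fun i j => coordDerivation_of_ne B hB) hF s hs _ h0
    (fun j => coordDerivation_minor_mem B hB hs hω hmax) (minor_pow_sub_mem B hB s hω)
  refine ⟨x, c.val, hx, ?_⟩
  rw [hc, map_nsmul, minor_logForm_self B hs fun k => (hx k).2, nsmul_eq_mul, ← ZMod.cast_eq_val]

include hB in
/-- Induction on leading terms: a subgroup `W` meets `ν_n` inside a subgroup `N` of `W` as soon as
`N` contains the logarithmic forms with the same leading terms as elements of `W`. -/
theorem mem_of_forall_logForm_mem [WellFoundedLT I] (hF : ∀ x : F, ∃ y : F, y ^ (p - 1) = x)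
    (W N : AddSubgroup (ExtOmega F)) (hNW : N ≤ W)
    (h : ∀ ω ∈ W, ∀ s : Fin n → I, StrictMono s → minor B s ω ≠ 0 → ∀ x : Fin n → F,
      (∀ k, x k ≠ 0 ∧ ∀ j, s k < j → coordDerivation B j (x k) = 0) → logForm F x ∈ N)
    {ω : ExtOmega F} (hωW : ω ∈ W) (hω : ω ∈ nuPow F n) : ω ∈ N := by
  by_cases hω0 : ω = 0
  · exact hω0 ▸ zero_mem N
  obtain ⟨s, hs, hs0, hsmax⟩ := exists_max_minor B (nuPow_natCast_le hω) hω0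
  generalize hS : toColex s = S at hsmax
  induction S using WellFoundedLT.induction generalizing ω s with
  | ind S ih =>
  subst hS
  obtain ⟨x, c, hx, hc⟩ := exists_logForm_minor_eq B hB hF hs hω hs0 fun τ hτ hsτ => by
    by_contra h1
    exact absurd (hsmax τ hτ h1) (not_le_of_gt (Pi.toColex_strictMono hsτ))
  have hxN := h ω hωW s hs hs0 x hx
  rw [← sub_add_cancel ω (c • logForm F x)]
  refine add_mem ?_ (nsmul_mem hxN c)
  by_cases h0 : ω - c • logForm F x = 0
  · exact h0 ▸ zero_mem N
  have h1 := sub_mem hω (nsmul_mem (logForm_mem_nuPow fun k => (hx k).1) c)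
  obtain ⟨s', hs', hs0', hsmax'⟩ := exists_max_minor B (nuPow_natCast_le h1) h0
  refine ih (toColex s') (lt_of_le_of_ne ?_ ?_) (sub_mem hωW (hNW (nsmul_mem hxN c))) h1 h0 s'
    hs' hs0' rfl hsmax'
  · by_contra h2
    refine hs0' ?_
    rw [map_sub, map_nsmul, minor_logForm_eq_zero B hs.monotone hs'.monotone
      (fun h3 => h2 (Pi.toColex_monotone h3)) fun k => (hx k).2, smul_zero, sub_zero]
    by_contra h3
    exact h2 (hsmax s' hs' h3)
  · intro h2
    refine hs0' ?_
    rw [toColex_inj.1 h2, map_sub, hc, sub_self]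

end LogForms

section Wedges

variable {F : Type} [Field F] {n : ℕ}

theorem dwedge_eq_ιMulti (u : Fin n → F) :
    dwedge F u = ExteriorAlgebra.ιMulti F n (KaehlerDifferential.D ℤ F ∘ u) := by
  rw [ExteriorAlgebra.ιMulti_apply]; rfl

theorem logForm_eq_ιMulti (x : Fin n → F) :
    logForm F x =
      ExteriorAlgebra.ιMulti F n fun i => (x i)⁻¹ • KaehlerDifferential.D ℤ F (x i) := by
  rw [ExteriorAlgebra.ιMulti_apply]; rfl

theorem dform_eq_dwedge (a : F) : dform F a = dwedge F fun _ : Fin 1 => a := by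
  simp [dwedge]

theorem ιMulti_add_apply {M : Type*} [AddCommGroup M] [Module F M] {t m : ℕ}
    (v : Fin (t + m) → M) :
    ExteriorAlgebra.ιMulti F (t + m) v = ExteriorAlgebra.ιMulti F t (v ∘ Fin.castAdd m) *
      ExteriorAlgebra.ιMulti F m (v ∘ Fin.natAdd t) := by
  simp only [ExteriorAlgebra.ιMulti_apply]
  rw [← List.prod_append, ← List.ofFn_fin_append]
  congr 2
  funext i
  induction i using Fin.addCases <;> simp

theorem logForm_add {t m : ℕ} (x : Fin (t + m) → F) :
    logForm F x = logForm F (x ∘ Fin.castAdd m) * logForm F (x ∘ Fin.natAdd t) := by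
  simp only [logForm_eq_ιMulti]
  exact ιMulti_add_apply _

theorem logForm_mul_mem_nuPow {t : ℕ} {y : Fin t → F} (hy : ∀ i, y i ≠ 0) {χ : ExtOmega F}
    (hχ : χ ∈ nuPow F ((n : ℤ) - t)) : logForm F y * χ ∈ nuPow F n := by
  rcases lt_or_ge n t with h | h
  · rw [nuPow, if_neg (by omega)] at hχ
    rw [AddSubgroup.mem_bot.1 hχ, mul_zero]
    exact zero_mem _
  · obtain ⟨m, rfl⟩ := Nat.exists_eq_add_of_le h
    rw [show ((t + m : ℕ) : ℤ) - t = (m : ℕ) by push_cast; ring] at hχ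
    refine nuPow_natCast_induction (P := fun χ => logForm F y * χ ∈ nuPow F (t + m : ℕ)) hχ
      (fun x hx => ?_) (by rw [mul_zero]; exact zero_mem _)
      (fun α β hα hβ => by rw [mul_add]; exact add_mem hα hβ)
      (fun α hα => by rw [mul_neg]; exact neg_mem hα)
    have h1 := logForm_add (Fin.append y x)
    rw [show Fin.append y x ∘ Fin.castAdd m = y from funext (Fin.append_left y x),
      show Fin.append y x ∘ Fin.natAdd t = x from funext (Fin.append_right y x)] at h1
    rw [← h1]
    refine logForm_mem_nuPow fun i => ?_
    induction i using Fin.addCases with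
    | left i => rw [Fin.append_left]; exact hy i
    | right i => rw [Fin.append_right]; exact hx i

theorem ιMulti_mul_mem {t : ℕ} (v : Fin t → Ω[F⁄ℤ]) {w : ExtOmega F}
    (hw : w ∈ OmegaPow F ((n : ℤ) - t)) :
    ExteriorAlgebra.ιMulti F t v * w ∈ ⋀[F]^n (Ω[F⁄ℤ]) := by
  rcases lt_or_ge n t with h | h
  · rw [OmegaPow, if_neg (by omega), Submodule.mem_bot] at hw
    rw [hw, mul_zero]
    exact zero_mem _
  · obtain ⟨m, rfl⟩ := Nat.exists_eq_add_of_le h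
    rw [show ((t + m : ℕ) : ℤ) - t = (m : ℕ) by push_cast; ring, OmegaPow_natCast] at hw
    rw [ExteriorAlgebra.exteriorPower, pow_add]
    exact Submodule.mul_mem_mul (ExteriorAlgebra.ιMulti_range F t ⟨v, rfl⟩) hw

theorem mem_logWedgeNu_of_logForm {K : Set F} {t : ℕ} (ht : t ≤ n) {x : Fin n → F}
    (hx : ∀ k, x k ≠ 0) (hK : ∀ k : Fin n, (k : ℕ) < t → x k ∈ K) :
    logForm F x ∈ logWedgeNu F K t ((n : ℤ) - t) := by
  obtain ⟨m, rfl⟩ := Nat.exists_eq_add_of_le ht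
  rw [show ((t + m : ℕ) : ℤ) - t = (m : ℕ) by push_cast; ring, logForm_add]
  exact AddSubgroup.subset_closure ⟨_, fun i => ⟨hK _ i.2, hx _⟩, _,
    logForm_mem_nuPow fun i => hx _, rfl⟩

theorem nuPow_le_OmegaPow (m : ℤ) {χ : ExtOmega F} (hχ : χ ∈ nuPow F m) : χ ∈ OmegaPow F m := by
  by_cases hm : 0 ≤ m
  · lift m to ℕ using hm
    rw [OmegaPow_natCast]
    exact nuPow_natCast_le hχ
  · rw [nuPow, if_neg hm] at hχ
    rw [AddSubgroup.mem_bot.1 hχ]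
    exact zero_mem _

variable {I : Type} [LinearOrder I] (B : Module.Basis I F Ω[F⁄ℤ])

/-- The forms all of whose nonzero coefficients have an index satisfying `P`. -/
def minorSupported (P : (Fin n → I) → Prop) : Submodule F (ExtOmega F) where
  carrier := {ω | ω ∈ ⋀[F]^n (Ω[F⁄ℤ]) ∧ ∀ s, StrictMono s → ¬ P s → minor B s ω = 0}
  add_mem' h h' := ⟨add_mem h.1 h'.1, fun s hs hP => by
    rw [map_add, h.2 s hs hP, h'.2 s hs hP, add_zero]⟩
  zero_mem' := ⟨zero_mem _, fun s _ _ => map_zero _⟩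
  smul_mem' c ω h := ⟨Submodule.smul_mem _ c h.1, fun s hs hP => by
    rw [map_smul, h.2 s hs hP, smul_zero]⟩

theorem ιMulti_mul_mem_minorSupported {T : Set I} (hT : IsLowerSet T) {t : ℕ}
    {P : (Fin n → I) → Prop} (hP : ∀ s, InitialIn T t s → P s) (v : Fin t → Ω[F⁄ℤ])
    (hv : ∀ k, ∀ i ∉ T, B.repr (v k) i = 0) {w : ExtOmega F}
    (hw : w ∈ OmegaPow F ((n : ℤ) - t)) :
    ExteriorAlgebra.ιMulti F t v * w ∈ minorSupported B P :=
  ⟨ιMulti_mul_mem v hw, fun s hs hPs => by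
    by_contra h
    exact hPs (hP s (initialIn_of_minor_ne_zero B hT hs v hv h))⟩

variable {b : I → F} (hB : ∀ i, B i = (b i)⁻¹ • KaehlerDifferential.D ℤ F (b i))

include hB in
theorem wedgeL_dwedge_le_minorSupported {T : Set I} (hT : IsLowerSet T) {t : ℕ}
    {P : (Fin n → I) → Prop} (hP : ∀ s, InitialIn T t s → P s) (τ : Fin t → I) (hτ : ∀ k, τ k ∈ T) :
    wedgeL F (dwedge F fun k => b (τ k)) (OmegaPow F ((n : ℤ) - t)) ≤ minorSupported B P := by
  rintro _ ⟨w, hw, rfl⟩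
  rw [LinearMap.mulLeft_apply, dwedge_eq_ιMulti]
  refine ιMulti_mul_mem_minorSupported B hT hP _ (fun k i hi => ?_) hw
  exact coordDerivation_of_ne B hB fun h => hi (h ▸ hτ k)

omit [LinearOrder I] in
include hB in
theorem ιMulti_mem_wedgeL_dwedge {t : ℕ} (ht : t ≤ n) (s : Fin n → I) :
    ExteriorAlgebra.ιMulti F n (B ∘ s) ∈
      wedgeL F (dwedge F fun k : Fin t => b (s (Fin.castLE ht k))) (OmegaPow F ((n : ℤ) - t)) := by
  obtain ⟨m, rfl⟩ := Nat.exists_eq_add_of_le ht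
  rw [show ((t + m : ℕ) : ℤ) - t = (m : ℕ) by push_cast; ring, OmegaPow_natCast, ιMulti_add_apply]
  have h : ExteriorAlgebra.ιMulti F t ((B ∘ s) ∘ Fin.castAdd m) =
      (∏ k : Fin t, (b (s (Fin.castAdd m k)))⁻¹) •
        dwedge F fun k : Fin t => b (s (Fin.castLE ht k)) := by
    rw [dwedge_eq_ιMulti, ← AlternatingMap.map_smul_univ]
    congr 1
    funext k
    exact hB _
  rw [h, smul_mul_assoc, ← mul_smul_comm]
  exact ⟨_, Submodule.smul_mem _ _ (ExteriorAlgebra.ιMulti_range F m ⟨_, rfl⟩), rfl⟩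

variable {p : ℕ} [Fact p.Prime] [CharP F p]

omit [LinearOrder I] [Fact p.Prime] in
include hB in
theorem coordDerivation_eq_zero_of_mem_pClosure {T : Set I} {x : F}
    (hx : x ∈ pClosure F p (b '' T)) {i : I} (hi : i ∉ T) : coordDerivation B i x = 0 := by
  have h := pClosure_le (K := constantsSubfield (coordDerivation B) {i})
    (fun y => by
      rw [mem_constantsSubfield]
      exact fun j _ => derivation_pow_char _ y) (C := b '' T) (by
      rintro _ ⟨j, hj, rfl⟩
      refine (mem_constantsSubfield _).2 ?_
      rintro k rfl
      exact coordDerivation_of_ne B hB fun h => hi (h ▸ hj)) hx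
  exact (mem_constantsSubfield _).1 h i rfl

omit [Fact p.Prime] in
include hB in
theorem logWedgeNu_le {T : Set I} (hT : IsLowerSet T) {t : ℕ} {P : (Fin n → I) → Prop}
    (hP : ∀ s, InitialIn T t s → P s) :
    logWedgeNu F (pClosure F p (b '' T)) t ((n : ℤ) - t) ≤
      (minorSupported B P).toAddSubgroup ⊓ nuPow F n := by
  refine (AddSubgroup.closure_le _).2 ?_
  rintro _ ⟨y, hy, χ, hχ, rfl⟩
  refine ⟨?_, logForm_mul_mem_nuPow (fun i => (hy i).2) hχ⟩
  rw [logForm_eq_ιMulti]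
  refine ιMulti_mul_mem_minorSupported B hT hP _ (fun k i hi => ?_) (nuPow_le_OmegaPow _ hχ)
  rw [map_smul, Finsupp.smul_apply, ← coordDerivation_apply,
    coordDerivation_eq_zero_of_mem_pClosure B hB (hy k).1 hi, smul_zero]

include hB in
theorem logForm_mem_logWedgeNu {T : Set I} (hT : IsLowerSet T) {t : ℕ} {s : Fin n → I}
    (hs : InitialIn T t s) {x : Fin n → F}
    (hx : ∀ k, x k ≠ 0 ∧ ∀ j, s k < j → coordDerivation B j (x k) = 0) :
    logForm F x ∈ logWedgeNu F (pClosure F p (b '' T)) t ((n : ℤ) - t) :=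
  mem_logWedgeNu_of_logForm hs.1 (fun k => (hx k).1) fun k hk =>
    mem_pClosure_of_coordDerivation_eq_zero B hB T fun i hi =>
      (hx k).2 i (lt_of_not_ge fun h => hi (hT h (hs.2 k hk)))

include hB in
theorem inf_nuPow_eq [WellFoundedLT I] (hF : ∀ x : F, ∃ y : F, y ^ (p - 1) = x)
    {P : (Fin n → I) → Prop} {W : Submodule F (ExtOmega F)} {N : AddSubgroup (ExtOmega F)}
    (hWP : W ≤ minorSupported B P)
    (hPW : ∀ s, StrictMono s → P s → ExteriorAlgebra.ιMulti F n (B ∘ s) ∈ W)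
    (hN : N ≤ (minorSupported B P).toAddSubgroup ⊓ nuPow F n)
    (hPN : ∀ s, P s → ∀ x : Fin n → F,
      (∀ k, x k ≠ 0 ∧ ∀ j, s k < j → coordDerivation B j (x k) = 0) → logForm F x ∈ N) :
    W.toAddSubgroup ⊓ nuPow F n = N := by
  have hP {ω : ExtOmega F} (hω : ω ∈ minorSupported B P) (s : Fin n → I) (hs : StrictMono s)
      (h0 : minor B s ω ≠ 0) : P s := by
    by_contra h
    exact h0 (hω.2 s hs h)
  have hW : W = minorSupported B P := le_antisymm hWP fun ω hω =>
    mem_of_minor B hω.1 W fun s hs h0 => hPW s hs (hP hω s hs h0)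
  rw [hW]
  refine le_antisymm (fun ω hω => ?_) hN
  exact mem_of_forall_logForm_mem B hB hF (minorSupported B P).toAddSubgroup N
    (hN.trans inf_le_left) (fun ω hω s hs h0 x hx => hPN s (hP hω s hs h0) x hx) hω.1 hω.2

end Wedges

/-- Lemma 4.2. Assume `F^{p−1} = F` and let `{a₁,…,a_r,e₁,…,e_ℓ}` be
`p`-independent. Then for every `t ∈ {1,…,ℓ}`:
`(Σᵢ d aᵢ ∧ Ω^{n−1}(F) + Σ_{i₁<…<i_t} d e_{i₁} ∧ … ∧ d e_{i_t} ∧ Ω^{n−t}(F)) ∩ ν_n(F)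
 = [dx/x ∣ x ∈ F^p(a₁,…,a_r)^*] ∧ ν_{n−1}(F)
   + [dy₁/y₁ ∧ … ∧ dy_t/y_t ∣ yᵢ ∈ F^p(a₁,…,a_r,e₁,…,e_ℓ)^*] ∧ ν_{n−t}(F)`;
moreover (the case `ℓ = 0`, `t = 0`):
`(Σᵢ d aᵢ ∧ Ω^{n−1}(F)) ∩ ν_n(F) = [dx/x ∣ x ∈ F^p(a₁,…,a_r)^*] ∧ ν_{n−1}(F)`. -/
theorem stmt11 (F : Type) [Field F] (p : ℕ) [Fact p.Prime] [CharP F p]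
    (hF : ∀ x : F, ∃ y : F, y ^ (p - 1) = x)
    (n r l : ℕ) (a : Fin r → F) (e : Fin l → F)
    (hind : pIndep F p (Fin.append a e)) :
    (∀ t : ℕ, 1 ≤ t → t ≤ l →
      ((⨆ i, wedgeL F (dform F (a i)) (OmegaPow F ((n : ℤ) - 1))) ⊔
          ⨆ c : Fin t ↪o Fin l,
            wedgeL F (dwedge F fun j => e (c j))
              (OmegaPow F ((n : ℤ) - t))).toAddSubgroup ⊓ nuPow F n =
        logWedgeNu F (pClosure F p (Set.range a)) 1 ((n : ℤ) - 1) ⊔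
          logWedgeNu F (pClosure F p (Set.range a ∪ Set.range e)) t ((n : ℤ) - t)) ∧
    ((⨆ i, wedgeL F (dform F (a i)) (OmegaPow F ((n : ℤ) - 1))).toAddSubgroup ⊓
        nuPow F n =
      logWedgeNu F (pClosure F p (Set.range a)) 1 ((n : ℤ) - 1)) := by
  obtain ⟨I, _, _, b, B, ι, hB, hι, hb, hlow⟩ := hind.exists_logBasis
  have hba (i : Fin r) : b (ι (Fin.castAdd l i)) = a i := by rw [hb, Fin.append_left]
  have hbe (i : Fin l) : b (ι (Fin.natAdd r i)) = e i := by rw [hb, Fin.append_right]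
  set Ta : Set I := Set.range (ι ∘ Fin.castAdd l) with hTa
  have hT : IsLowerSet (Set.range ι) := by
    rintro _ i hi ⟨j, rfl⟩
    rcases hi.lt_or_eq with h | h
    · exact hlow i j h
    · exact ⟨j, h.symm⟩
  have hTa_lower : IsLowerSet Ta := by
    rintro _ i hi ⟨j, rfl⟩
    obtain ⟨k, rfl⟩ := hT hi ⟨_, rfl⟩
    have hk : (k : ℕ) ≤ j := hι.le_iff_le.1 hi
    exact ⟨⟨k, hk.trans_lt j.2⟩, rfl⟩
  have himg_a : b '' Ta = Set.range a := by
    rw [hTa, ← Set.range_comp]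
    exact congrArg Set.range (funext hba)
  have himg : b '' Set.range ι = Set.range a ∪ Set.range e := by
    rw [← Set.range_comp, show b ∘ ι = Fin.append a e from funext hb]
    refine Set.Subset.antisymm ?_ (Set.union_subset ?_ ?_)
    · rintro _ ⟨i, rfl⟩
      induction i using Fin.addCases with
      | left i => exact Or.inl ⟨i, (Fin.append_left a e i).symm⟩
      | right i => exact Or.inr ⟨i, (Fin.append_right a e i).symm⟩
    · rintro _ ⟨i, rfl⟩
      exact ⟨_, Fin.append_left a e i⟩
    · rintro _ ⟨i, rfl⟩
      exact ⟨_, Fin.append_right a e i⟩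
  have hWa (P : (Fin n → I) → Prop) (hP : ∀ s, InitialIn Ta 1 s → P s) :
      ⨆ i, wedgeL F (dform F (a i)) (OmegaPow F ((n : ℤ) - 1)) ≤ minorSupported B P := by
    refine iSup_le fun i => ?_
    rw [dform_eq_dwedge, ← hba, ← Nat.cast_one]
    exact wedgeL_dwedge_le_minorSupported B hB hTa_lower hP _ fun _ => ⟨i, rfl⟩
  have hmem_a (s : Fin n → I) (hs : InitialIn Ta 1 s) : ExteriorAlgebra.ιMulti F n (B ∘ s) ∈
      ⨆ i, wedgeL F (dform F (a i)) (OmegaPow F ((n : ℤ) - 1)) := by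
    obtain ⟨i, hi⟩ := hs.2 (Fin.castLE hs.1 0) (by simp)
    refine Submodule.mem_iSup_of_mem i ?_
    have h := ιMulti_mem_wedgeL_dwedge B hB hs.1 s
    rw [show (fun k : Fin 1 => b (s (Fin.castLE hs.1 k))) = fun _ => a i from funext fun k => by
      rw [Subsingleton.elim k 0, ← hi]; exact hba i, ← dform_eq_dwedge, Nat.cast_one] at h
    exact h
  have hNa (P : (Fin n → I) → Prop) (hP : ∀ s, InitialIn Ta 1 s → P s) :
      logWedgeNu F (pClosure F p (Set.range a)) 1 ((n : ℤ) - 1) ≤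
        (minorSupported B P).toAddSubgroup ⊓ nuPow F n := by
    have h := logWedgeNu_le (p := p) B hB hTa_lower hP
    rwa [himg_a, Nat.cast_one] at h
  have hlog_a (s : Fin n → I) (hs : InitialIn Ta 1 s) (x : Fin n → F)
      (hx : ∀ k, x k ≠ 0 ∧ ∀ j, s k < j → coordDerivation B j (x k) = 0) :
      logForm F x ∈ logWedgeNu F (pClosure F p (Set.range a)) 1 ((n : ℤ) - 1) := by
    have h := logForm_mem_logWedgeNu (p := p) B hB hTa_lower hs hx
    rwa [himg_a, Nat.cast_one] at h
  refine ⟨fun t ht _ => ?_, ?_⟩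
  · refine inf_nuPow_eq B hB hF
      (P := fun s => InitialIn Ta 1 s ∨ InitialIn (Set.range ι) t s)
      (sup_le (hWa _ fun s => Or.inl) (iSup_le fun c => ?_)) (fun s hs hPs => ?_)
      (sup_le (hNa _ fun s => Or.inl) ?_) (fun s hPs x hx => ?_)
    · have h := wedgeL_dwedge_le_minorSupported (n := n) B hB hT
        (P := fun s => InitialIn Ta 1 s ∨ InitialIn (Set.range ι) t s) (fun s => Or.inr)
        (fun k => ι (Fin.natAdd r (c k))) (fun k => ⟨_, rfl⟩)
      simpa only [hbe] using h
    · by_cases hsa : InitialIn Ta 1 s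
      · exact Submodule.mem_sup_left (hmem_a s hsa)
      · obtain ⟨htn, hst⟩ := hPs.resolve_left hsa
        have hnot (k : Fin n) : s k ∉ Ta := fun hk =>
          hsa ⟨ht.trans htn, fun j hj => hTa_lower (hs.monotone (Fin.le_def.2 (by omega))) hk⟩
        have hc (k : Fin t) : ∃ j, ι (Fin.natAdd r j) = s (Fin.castLE htn k) := by
          obtain ⟨j, hj⟩ := hst (Fin.castLE htn k) k.2
          induction j using Fin.addCases with
          | left j => exact absurd ⟨j, hj⟩ (hnot _)
          | right j => exact ⟨j, hj⟩
        choose c hc using hc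
        have hcm : StrictMono c := fun i j hij => by
          have h : ι (Fin.natAdd r (c i)) < ι (Fin.natAdd r (c j)) := by
            rw [hc, hc]
            exact hs (Fin.castLE_lt_castLE_iff _ |>.2 hij)
          simpa using hι.lt_iff_lt.1 h
        refine Submodule.mem_sup_right
          (Submodule.mem_iSup_of_mem (OrderEmbedding.ofStrictMono c hcm) ?_)
        have h := ιMulti_mem_wedgeL_dwedge B hB htn s
        simp only [← hc, hbe] at h
        exact h
    · rw [← himg]
      exact logWedgeNu_le B hB hT fun s => Or.inr
    · rcases hPs with hs | hs
      · exact AddSubgroup.mem_sup_left (hlog_a s hs x hx)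
      · rw [← himg]
        exact AddSubgroup.mem_sup_right (logForm_mem_logWedgeNu B hB hT hs hx)
  · exact inf_nuPow_eq B hB hF (P := InitialIn Ta 1) (hWa _ fun s => id)
      (fun s _ => hmem_a s) (hNa _ fun s => id) hlog_a
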